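/- Let k be an even integer ≥ 4 and M := ⌊k/6⌋. For 1 ≤ m ≤ M set t_m := (1/2)·cot(mπ/(k+1)). Then t_1 > t_2 > ⋯ > t_M > √3/2. For each integer m with 1 ≤ m ≤ M−1, E_k' has exactly one zero in the open segment {1/2 + it : t_{m+1} < t < t_m}. Moreover, when k ≡ 4 (mod 6) and k ≠ 4, E_k' has exactly one zero in the open segment {1/2 + it : √3/2 < t < t_M}. -/

import Mathlib

/-- The normalized Eisenstein series of even weight `k ≥ 4` (the definition also
makes sense for `k = 2`, giving the quasi-modular Eisenstein series `E₂`), defined by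
its Fourier expansion `E_k(z) = 1 - (2k/B_k) ∑_{n≥1} σ_{k-1}(n) qⁿ`, `q = exp(2πiz)`. -/
noncomputable def Ek (k : ℕ) (z : ℂ) : ℂ :=
  1 - (2 * (k : ℂ) / ((bernoulli k : ℚ) : ℂ)) *
    ∑' n : ℕ, (∑ d ∈ n.divisors, (d : ℂ) ^ (k - 1)) * Complex.exp (2 * Real.pi * Complex.I * z) ^ n

/-- The series `∑ n ^ p σ_{k-1}(n) qⁿ`. -/
noncomputable def divSeries (k p : ℕ) (z : ℂ) : ℂ :=
  ∑' n : ℕ, (n : ℂ) ^ p * (∑ d ∈ n.divisors, (d : ℂ) ^ (k - 1)) *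
    Complex.exp (2 * Real.pi * Complex.I * z) ^ n

/-- The series `∑ n ^ p σ_{k-1}(n) qⁿ` on the line `Re z = 1 / 2`. -/
noncomputable def realSeries (k p : ℕ) (t : ℝ) : ℝ :=
  ∑' n : ℕ, (n : ℝ) ^ p * (∑ d ∈ n.divisors, (d : ℝ) ^ (k - 1)) *
    (-Real.exp (-(2 * Real.pi * t))) ^ n

lemma divSeries_half_add (k p : ℕ) (t : ℝ) :
    divSeries k p (1 / 2 + t * Complex.I) = (realSeries k p t : ℂ) := by
  have h : Complex.exp (2 * Real.pi * Complex.I * (1 / 2 + t * Complex.I)) =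
      ((-Real.exp (-(2 * Real.pi * t)) : ℝ) : ℂ) := by
    rw [show 2 * Real.pi * Complex.I * (1 / 2 + t * Complex.I) =
        Real.pi * Complex.I + ((-(2 * Real.pi * t) : ℝ) : ℂ) by
      push_cast; ring_nf; rw [Complex.I_sq]; ring, Complex.exp_add, Complex.exp_pi_mul_I]
    push_cast; ring
  rw [divSeries, realSeries, h, Complex.ofReal_tsum]
  push_cast; rfl

lemma norm_sum_divisors_pow_le (l n : ℕ) :
    ‖∑ d ∈ n.divisors, (d : ℂ) ^ l‖ ≤ (n : ℝ) ^ (l + 1) := by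
  calc ‖∑ d ∈ n.divisors, (d : ℂ) ^ l‖ ≤ ∑ d ∈ n.divisors, (n : ℝ) ^ l := by
        refine norm_sum_le_of_le _ fun d hd => ?_
        rw [norm_pow, Complex.norm_natCast]
        have := Nat.divisor_le hd
        gcongr
    _ ≤ (n : ℝ) ^ (l + 1) := by
        rw [Finset.sum_const, nsmul_eq_mul, pow_succ, mul_comm]
        gcongr
        exact_mod_cast Nat.card_divisors_le_self n

lemma norm_exp_two_pi_I_mul (z : ℂ) :
    ‖Complex.exp (2 * Real.pi * Complex.I * z)‖ = Real.exp (-(2 * Real.pi * z.im)) := by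
  rw [Complex.norm_exp]; congr 1; simp

lemma norm_divSeries_term_le (k p n : ℕ) {r : ℝ} {w : ℂ} (h : ‖w‖ ≤ r) :
    ‖(n : ℂ) ^ p * (∑ d ∈ n.divisors, (d : ℂ) ^ (k - 1)) * w ^ n‖ ≤
      (n : ℝ) ^ (p + (k - 1 + 1)) * r ^ n := by
  rw [norm_mul, norm_mul, norm_pow, norm_pow, Complex.norm_natCast, pow_add]
  have := norm_sum_divisors_pow_le (k - 1) n
  gcongr

lemma summable_pow_mul_pow (l : ℕ) {r : ℝ} (h0 : 0 ≤ r) (h : r < 1) :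
    Summable fun n : ℕ => (n : ℝ) ^ l * r ^ n :=
  summable_pow_mul_geometric_of_norm_lt_one l (by rwa [Real.norm_of_nonneg h0])

lemma hasDerivAt_divSeries (k p : ℕ) {z : ℂ} (hz : 0 < z.im) :
    HasDerivAt (divSeries k p) (2 * Real.pi * Complex.I * divSeries k (p + 1) z) z := by
  set r := Real.exp (-(2 * Real.pi * (z.im / 2)))
  have hr : r < 1 := by
    rw [Real.exp_lt_one_iff]; have := Real.pi_pos; nlinarith [mul_pos this hz]
  have hw : ∀ y : ℂ, z.im / 2 < y.im → ‖Complex.exp (2 * Real.pi * Complex.I * y)‖ ≤ r := by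
    intro y hy
    rw [norm_exp_two_pi_I_mul]
    apply Real.exp_le_exp.2
    have := Real.pi_pos
    nlinarith
  have key := hasDerivAt_tsum_of_isPreconnected (𝕜 := ℂ)
    (g := fun (n : ℕ) (y : ℂ) => (n : ℂ) ^ p * (∑ d ∈ n.divisors, (d : ℂ) ^ (k - 1)) *
      Complex.exp (2 * Real.pi * Complex.I * y) ^ n)
    (g' := fun (n : ℕ) (y : ℂ) => 2 * Real.pi * Complex.I * ((n : ℂ) ^ (p + 1) *
      (∑ d ∈ n.divisors, (d : ℂ) ^ (k - 1)) * Complex.exp (2 * Real.pi * Complex.I * y) ^ n))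
    (u := fun n : ℕ => 2 * Real.pi * ((n : ℝ) ^ (p + 1 + (k - 1 + 1)) * r ^ n))
    (t := {y : ℂ | z.im / 2 < y.im}) (y₀ := z) (y := z)
    ((summable_pow_mul_pow _ (Real.exp_pos _).le hr).mul_left _)
    (isOpen_lt continuous_const Complex.continuous_im)
    (convex_halfSpace_im_gt _).isPreconnected ?_ ?_ (by simpa using hz) ?_ (by simpa using hz)
  · rw [tsum_mul_left] at key
    exact key
  · intro n y _
    have h1 : HasDerivAt (fun y : ℂ => Complex.exp (2 * Real.pi * Complex.I * y) ^ n)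
        (n * (2 * Real.pi * Complex.I) * Complex.exp (2 * Real.pi * Complex.I * y) ^ n) y := by
      have h2 : HasDerivAt (fun y : ℂ => Complex.exp ((n * (2 * Real.pi * Complex.I)) * y))
        (Complex.exp ((n * (2 * Real.pi * Complex.I)) * y) * (n * (2 * Real.pi * Complex.I))) y :=
        (by simpa using (hasDerivAt_id y).const_mul ((n : ℂ) * (2 * Real.pi * Complex.I))
          : HasDerivAt _ _ y).cexp
      have h3 : ∀ y : ℂ, Complex.exp (2 * Real.pi * Complex.I * y) ^ n =
          Complex.exp ((n * (2 * Real.pi * Complex.I)) * y) := fun y => by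
        rw [← Complex.exp_nat_mul]; congr 1; ring
      simp_rw [h3]
      exact h2.congr_deriv (mul_comm _ _)
    refine (h1.const_mul ((n : ℂ) ^ p * (∑ d ∈ n.divisors, (d : ℂ) ^ (k - 1)))).congr_deriv ?_
    ring
  · intro n y hy
    rw [norm_mul]
    have := norm_divSeries_term_le k (p + 1) n (hw y hy)
    have h2 : ‖(2 * Real.pi * Complex.I : ℂ)‖ = 2 * Real.pi := by
      simp [abs_of_pos Real.pi_pos]
    rw [h2]
    have := Real.pi_pos
    gcongr
  · refine Summable.of_norm_bounded (summable_pow_mul_pow (p + (k - 1 + 1)) (Real.exp_pos _).le hr)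
      fun n => norm_divSeries_term_le k p n (hw z (by simpa using hz))

lemma summable_divSeries (k p : ℕ) {q : ℂ} (hq : ‖q‖ < 1) :
    Summable fun n : ℕ => (n : ℂ) ^ p * (∑ d ∈ n.divisors, (d : ℂ) ^ (k - 1)) * q ^ n :=
  Summable.of_norm_bounded (summable_pow_mul_pow (p + (k - 1 + 1)) (norm_nonneg _) hq)
    fun n => norm_divSeries_term_le k p n le_rfl

lemma summable_realSeries (k p : ℕ) {t : ℝ} (ht : 0 < t) :
    Summable fun n : ℕ => (n : ℝ) ^ p * (∑ d ∈ n.divisors, (d : ℝ) ^ (k - 1)) *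
      (-Real.exp (-(2 * Real.pi * t))) ^ n := by
  have h := summable_divSeries k p (q := ((-Real.exp (-(2 * Real.pi * t)) : ℝ) : ℂ)) (by
    rw [Complex.norm_real, norm_neg, Real.norm_of_nonneg (Real.exp_pos _).le, Real.exp_lt_one_iff]
    have := mul_pos Real.pi_pos ht
    linarith)
  rw [← Complex.summable_ofReal]
  convert h using 2 with n
  push_cast; rfl

lemma hasDerivAt_realSeries (k p : ℕ) {t : ℝ} (ht : 0 < t) :
    HasDerivAt (realSeries k p) (-(2 * Real.pi) * realSeries k (p + 1) t) t := by
  have h1 : HasDerivAt (fun w : ℂ => divSeries k p (1 / 2 + w * Complex.I))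
      ((-(2 * Real.pi) * realSeries k (p + 1) t : ℝ) : ℂ) (t : ℂ) := by
    have h2 : HasDerivAt (fun w : ℂ => 1 / 2 + w * Complex.I) Complex.I (t : ℂ) := by
      simpa using ((hasDerivAt_id (t : ℂ)).mul_const Complex.I).const_add (1 / 2)
    have h3 := (hasDerivAt_divSeries k p (z := 1 / 2 + t * Complex.I) (by simpa using ht)).comp
      (t : ℂ) h2
    refine h3.congr_deriv ?_
    rw [divSeries_half_add]
    push_cast
    linear_combination (2 * Real.pi * (realSeries k (p + 1) t : ℂ)) * Complex.I_sq
  have h4 := h1.real_of_complex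
  simpa only [divSeries_half_add, Complex.ofReal_re] using h4

lemma bernoulli_ne_zero_of_even {k : ℕ} (hk : Even k) (h0 : k ≠ 0) : bernoulli k ≠ 0 := by
  obtain ⟨l, rfl⟩ := hk
  intro h
  have h1 := riemannZeta_two_mul_nat (k := l) (by omega)
  rw [← two_mul] at h
  have h2 : riemannZeta (2 * l) = 0 := by rw [h1, h]; simp
  refine riemannZeta_ne_zero_of_one_le_re ?_ h2
  have : 1 ≤ l := by omega
  have : (1 : ℝ) ≤ l := by exact_mod_cast this
  simp; linarith

lemma deriv_Ek_eq_zero_iff {k : ℕ} (hk : Even k) (h0 : k ≠ 0) {t : ℝ} (ht : 0 < t) :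
    deriv (Ek k) (1 / 2 + t * Complex.I) = 0 ↔ realSeries k 1 t = 0 := by
  have hE : Ek k = fun z => 1 - (2 * (k : ℂ) / ((bernoulli k : ℚ) : ℂ)) * divSeries k 0 z := by
    ext z; simp [Ek, divSeries]
  have h1 := ((hasDerivAt_divSeries k 0 (z := 1 / 2 + t * Complex.I)
    (by simpa using ht)).const_mul (2 * (k : ℂ) / ((bernoulli k : ℚ) : ℂ))).const_sub 1
  rw [hE, h1.deriv, divSeries_half_add]
  simp [bernoulli_ne_zero_of_even hk h0, h0, Real.pi_ne_zero]

/-- The point `c cos θ - i (c + 2 n) sin θ`, proportional to `c z + n` for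
`z = 1 / 2 + i cot θ / 2`. -/
noncomputable def latticePt (θ : ℝ) (c : ℕ+) (n : ℤ) : ℂ :=
  ⟨c * Real.cos θ, -((c + 2 * n) * Real.sin θ)⟩

lemma tsum_mul_sigma_eq_tsum_prod (k p : ℕ) {q : ℂ} (hq : ‖q‖ < 1) :
    ∑' n : ℕ, (n : ℂ) ^ p * (∑ d ∈ n.divisors, (d : ℂ) ^ (k - 1)) * q ^ n =
      ∑' c : ℕ+, ∑' d : ℕ+, (c : ℂ) ^ p * ((d : ℂ) ^ (k - 1 + p) * (q ^ (c : ℕ)) ^ (d : ℕ)) := by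
  have hsum : Summable fun x : ℕ+ × ℕ+ =>
      (x.1 : ℂ) ^ p * ((x.2 : ℂ) ^ (k - 1 + p) * (q ^ (x.1 : ℕ)) ^ (x.2 : ℕ)) := by
    rw [← sigmaAntidiagonalEquivProd.summable_iff]
    apply Summable.of_norm
    rw [summable_sigma_of_nonneg (fun a ↦ by positivity)]
    refine ⟨fun n => (hasSum_fintype _).summable, ?_⟩
    refine Summable.of_nonneg_of_le (fun b => tsum_nonneg fun _ => norm_nonneg _) (fun b => ?_)
      ((summable_pow_mul_pow (p + (k - 1 + 1)) (norm_nonneg _) hq).comp_injective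
        PNat.coe_injective)
    rw [tsum_fintype]
    calc _ ≤ ∑ x : (b : ℕ).divisorsAntidiagonal, (b : ℝ) ^ (p + (k - 1)) * ‖q‖ ^ (b : ℕ) := by
          refine Finset.sum_le_sum fun x _ => ?_
          have hx' : ((sigmaAntidiagonalEquivProd ⟨b, x⟩).1 : ℕ) *
            ((sigmaAntidiagonalEquivProd ⟨b, x⟩).2 : ℕ) = b := divisorsAntidiagonalFactors_eq x
          simp only [Function.comp]
          generalize sigmaAntidiagonalEquivProd ⟨b, x⟩ = y at hx' ⊢
          have h2 : (y.2 : ℕ) ≤ b := by rw [← hx']; exact Nat.le_mul_of_pos_left _ y.1.pos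
          rw [norm_mul, norm_mul, norm_pow, norm_pow, norm_pow, norm_pow, Complex.norm_natCast,
            Complex.norm_natCast, ← pow_mul, hx', pow_add, mul_comm ((y.2 : ℝ) ^ (k - 1)),
            ← mul_assoc, ← mul_assoc, ← mul_pow, pow_add]
          have h3 : ((y.1 : ℕ) : ℝ) * ((y.2 : ℕ) : ℝ) = (b : ℕ) := by exact_mod_cast hx'
          rw [h3]
          gcongr
      _ ≤ _ := by
          rw [Finset.sum_const, nsmul_eq_mul, Finset.card_univ, Fintype.card_coe]
          have : ((b : ℕ).divisorsAntidiagonal.card : ℝ) ≤ (b : ℕ) := by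
            rw [← Nat.map_div_right_divisors, Finset.card_map]
            exact_mod_cast Nat.card_divisors_le_self b
          calc _ ≤ ((b : ℕ) : ℝ) * ((b : ℝ) ^ (p + (k - 1)) * ‖q‖ ^ (b : ℕ)) := by gcongr
            _ = _ := by simp only [Function.comp]; ring
  have hsum' := sigmaAntidiagonalEquivProd.summable_iff.2 hsum
  simp only [Function.comp_def] at hsum'
  rw [← hsum.tsum_prod, ← sigmaAntidiagonalEquivProd.tsum_eq, hsum'.tsum_sigma,
    ← tsum_zero_pnat_eq_tsum_nat
    (summable_divSeries k p hq)]
  simp only [Nat.divisors_zero, Finset.sum_empty, mul_zero, zero_mul, zero_add]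
  refine tsum_congr fun n => ?_
  rw [tsum_fintype]
  have : ∀ x : (n : ℕ).divisorsAntidiagonal,
      ((sigmaAntidiagonalEquivProd ⟨n, x⟩).1 : ℂ) ^ p *
        (((sigmaAntidiagonalEquivProd ⟨n, x⟩).2 : ℂ) ^ (k - 1 + p) *
        (q ^ ((sigmaAntidiagonalEquivProd ⟨n, x⟩).1 : ℕ)) ^
          ((sigmaAntidiagonalEquivProd ⟨n, x⟩).2 : ℕ)) =
      (n : ℂ) ^ p * ((x.1.2 : ℂ) ^ (k - 1)) * q ^ (n : ℕ) := by
    intro x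
    have hx := (Nat.mem_divisorsAntidiagonal.mp x.2).1
    have hc : ((n : ℕ) : ℂ) = (x.1.1 : ℂ) * (x.1.2 : ℂ) := by exact_mod_cast hx.symm
    have h1 : ((sigmaAntidiagonalEquivProd ⟨n, x⟩).1 : ℕ) = x.1.1 := rfl
    have h2 : ((sigmaAntidiagonalEquivProd ⟨n, x⟩).2 : ℕ) = x.1.2 := rfl
    rw [← pow_mul, h1, h2, hx, hc]
    ring
  rw [Finset.sum_congr rfl fun x _ => this x, ← Finset.sum_mul, ← Finset.mul_sum]
  congr 2
  rw [Finset.univ_eq_attach,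
    (n : ℕ).divisorsAntidiagonal.sum_attach (fun x : ℕ × ℕ => (x.2 : ℂ) ^ (k - 1)),
    Nat.sum_divisorsAntidiagonal' (fun _ y => (y : ℂ) ^ (k - 1))]

lemma divSeries_eq_lattice (k p : ℕ) (hk : 2 ≤ k) {θ : ℝ} (h0 : 0 < Real.sin θ)
    (h1 : 0 < Real.cos θ) :
    divSeries k p (1 / 2 + (Real.cot θ / 2 : ℝ) * Complex.I) =
      ((k - 1 + p).factorial : ℂ) * ((Real.sin θ / Real.pi : ℝ) : ℂ) ^ (k + p) *
        ∑' c : ℕ+, ∑' n : ℤ, (c : ℂ) ^ p / latticePt θ c n ^ (k + p) := by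
  set z : ℂ := 1 / 2 + (Real.cot θ / 2 : ℝ) * Complex.I
  have hcot : 0 < Real.cot θ := by rw [Real.cot_eq_cos_div_sin]; positivity
  have hz : 0 < z.im := by
    simp only [z, Complex.add_im, Complex.im_ofReal_mul, Complex.I_im]
    simpa using hcot
  have hq : ‖Complex.exp (2 * Real.pi * Complex.I * z)‖ < 1 := by
    rw [norm_exp_two_pi_I_mul, Real.exp_lt_one_iff]
    have := mul_pos Real.pi_pos hz
    linarith
  rw [divSeries, tsum_mul_sigma_eq_tsum_prod k p hq, ← tsum_mul_left]
  refine tsum_congr fun c => ?_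
  have hcz : 0 < ((c : ℂ) * z).im := by
    rw [← Complex.ofReal_natCast, Complex.im_ofReal_mul]
    exact mul_pos (by exact_mod_cast c.pos) hz
  have hL := EisensteinSeries.qExpansion_identity_pnat (k := k - 1 + p) (by omega)
    ⟨(c : ℂ) * z, hcz⟩
  simp only at hL
  have hpi : (Real.pi : ℂ) ≠ 0 := by exact_mod_cast Real.pi_ne_zero
  have hs : (Real.sin θ : ℂ) ≠ 0 := by exact_mod_cast h0.ne'
  have hkp : k - 1 + p + 1 = k + p := by omega
  have hw : ∀ n : ℤ, (c : ℂ) * z + n =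
      Complex.I / (2 * Real.sin θ) * latticePt θ c n := by
    intro n
    have : latticePt θ c n =
        (c : ℂ) * Real.cos θ - Complex.I * ((c + 2 * n) * Real.sin θ) := by
      apply Complex.ext <;> simp [latticePt, -Complex.ofReal_cos, -Complex.ofReal_sin]
    rw [this, show z = 1 / 2 + Real.cos θ / Real.sin θ / 2 * Complex.I by
      simp [z, Real.cot_eq_cos_div_sin]]
    field_simp
    ring_nf
    rw [Complex.I_sq]
    ring
  rw [tsum_mul_left]
  have hexp : ∀ d : ℕ+, (Complex.exp (2 * Real.pi * Complex.I * z) ^ (c : ℕ)) ^ (d : ℕ) =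
      Complex.exp (2 * Real.pi * Complex.I * ((c : ℂ) * z)) ^ (d : ℕ) := by
    intro d
    rw [← Complex.exp_nat_mul _ (c : ℕ)]; congr 2; ring
  simp_rw [hexp]
  rw [hkp] at hL
  have hfac : (((k - 1 + p).factorial : ℕ) : ℂ) ≠ 0 := by exact_mod_cast Nat.factorial_ne_zero _
  have hP : ∑' d : ℕ+, (d : ℂ) ^ (k - 1 + p) *
      Complex.exp (2 * Real.pi * Complex.I * ((c : ℂ) * z)) ^ (d : ℕ) =
      ((k - 1 + p).factorial : ℂ) / (-2 * Real.pi * Complex.I) ^ (k + p) *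
        ∑' n : ℤ, 1 / ((c : ℂ) * z + n) ^ (k + p) := by
    rw [hL]
    field_simp
  rw [hP]
  simp_rw [hw, div_eq_mul_inv ((c : ℂ) ^ p), tsum_mul_left, mul_pow, one_div, mul_inv,
    tsum_mul_left]
  have : ((-2 * Real.pi * Complex.I) ^ (k + p))⁻¹ *
      ((Complex.I / (2 * Real.sin θ)) ^ (k + p))⁻¹ =
      ((Real.sin θ / Real.pi : ℝ) : ℂ) ^ (k + p) := by
    rw [← mul_inv, ← mul_pow, ← inv_pow]
    congr 1
    push_cast
    rw [show -2 * Real.pi * Complex.I * (Complex.I / (2 * Complex.sin θ)) =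
      -(Complex.I * Complex.I) * Real.pi / Complex.sin θ by ring, Complex.I_mul_I]
    simp
  rw [← this]
  ring

lemma one_add_pow_five_le_pow {r a : ℝ} {K : ℕ} (hK : 10 ≤ K) (hr : 0 ≤ r) (ha : 0 ≤ a)
    (h : 1 + a ≤ r ^ 2) : (1 + K * a / 10) ^ 5 ≤ r ^ K := by
  have hK' : (10 : ℝ) ≤ K := by exact_mod_cast hK
  have h1 : 1 + (K / 10 : ℝ) * a ≤ (1 + a) ^ (K / 10 : ℝ) :=
    one_add_mul_self_le_rpow_one_add (by linarith) (by linarith)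
  calc (1 + K * a / 10) ^ 5 ≤ ((1 + a) ^ (K / 10 : ℝ)) ^ 5 := by
        refine pow_le_pow_left₀ (by positivity) ?_ 5
        calc 1 + K * a / 10 = 1 + (K / 10 : ℝ) * a := by ring
          _ ≤ _ := h1
    _ ≤ ((r ^ 2) ^ (K / 10 : ℝ)) ^ 5 := by gcongr
    _ = r ^ K := by
        rw [← Real.rpow_natCast _ 5, ← Real.rpow_natCast r 2, ← Real.rpow_mul hr,
          ← Real.rpow_mul hr, ← Real.rpow_natCast r K]
        congr 1; push_cast; ring

lemma norm_latticePt_sq (θ : ℝ) (c : ℕ+) (n : ℤ) :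
    ‖latticePt θ c n‖ ^ 2 =
      (c * Real.cos θ) ^ 2 + ((c + 2 * n) * Real.sin θ) ^ 2 := by
  rw [← Complex.normSq_eq_norm_sq, Complex.normSq_apply, latticePt]; ring

lemma norm_latticePt_ge (θ : ℝ) (c : ℕ+) (n : ℤ) :
    c * Real.cos θ ≤ ‖latticePt θ c n‖ := by
  refine le_of_sq_le_sq ?_ (norm_nonneg _)
  rw [norm_latticePt_sq]; nlinarith [sq_nonneg ((c + 2 * n) * Real.sin θ)]

/-- Decay in `n` of the inner terms at height `c`. -/
lemma max_div_norm_latticePt_pow_le {θ : ℝ} {K : ℕ} (hK : 10 ≤ K) (hc : 0 < Real.cos θ)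
    (hs : 79 / 100 ≤ K * Real.sin θ ^ 2) (c : ℕ+) (n : ℤ) :
    max (c : ℝ) |(c : ℝ) + 2 * n| / ‖latticePt θ c n‖ ^ K ≤
      26 / 10 * c ^ 3 / (c * Real.cos θ) ^ K * (1 / (1 + ((c : ℝ) + 2 * n) ^ 2)) := by
  have hc1 : (1 : ℝ) ≤ c := by exact_mod_cast c.pos
  obtain ⟨y, hy⟩ : ∃ y : ℝ, y = |(c : ℝ) + 2 * n| / c := ⟨_, rfl⟩
  have hy0 : 0 ≤ y := by rw [hy]; positivity
  have hyc : |(c : ℝ) + 2 * n| = c * y := by rw [hy]; field_simp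
  have hy2 : ((c : ℝ) + 2 * n) ^ 2 = (c * y) ^ 2 := by rw [← hyc, sq_abs]
  have hcc : 0 < (c : ℝ) * Real.cos θ := by positivity
  have h1 : (1 + K * (y ^ 2 * Real.sin θ ^ 2) / 10) ^ 5 ≤
      (‖latticePt θ c n‖ / (c * Real.cos θ)) ^ K := by
    refine one_add_pow_five_le_pow hK (by positivity) (by positivity) ?_
    rw [div_pow, norm_latticePt_sq, le_div_iff₀ (by positivity), mul_pow (_ + _), hy2]
    have h1 : Real.cos θ ^ 2 ≤ 1 := Real.cos_sq_le_one θ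
    have h2 : 0 ≤ (c * y) ^ 2 * Real.sin θ ^ 2 := by positivity
    nlinarith
  have h2 : (1 + 79 / 1000 * y ^ 2) ^ 5 ≤ (‖latticePt θ c n‖ / (c * Real.cos θ)) ^ K := by
    refine le_trans ?_ h1
    refine pow_le_pow_left₀ (by positivity) ?_ 5
    nlinarith [mul_le_mul_of_nonneg_left hs (sq_nonneg y)]
  have h3 : max 1 y * (1 + y ^ 2) ≤ 26 / 10 * (1 + 79 / 1000 * y ^ 2) ^ 5 := by
    have h4 : max 1 y ≤ 216 / 1000 * y ^ 2 + 1158 / 1000 := by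
      apply max_le <;> nlinarith [sq_nonneg (y - 2.315)]
    have h5 : 0 ≤ y ^ 2 := sq_nonneg y
    calc max 1 y * (1 + y ^ 2) ≤ (216 / 1000 * y ^ 2 + 1158 / 1000) * (1 + y ^ 2) := by gcongr
      _ ≤ _ := by
        generalize y ^ 2 = v at h5
        nlinarith [mul_nonneg h5 (sq_nonneg (v - 5)), mul_nonneg h5 (sq_nonneg (v ^ 2 - 25)),
          sq_nonneg (v - 5), sq_nonneg (v ^ 2 - 25), sq_nonneg (v * (v - 5)),
          pow_nonneg h5 3, pow_nonneg h5 4, pow_nonneg h5 5]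
  have hN : 0 < ‖latticePt θ c n‖ := lt_of_lt_of_le hcc (norm_latticePt_ge θ c n)
  rw [div_pow, le_div_iff₀ (by positivity)] at h2
  have hm : max (c : ℝ) |(c : ℝ) + 2 * n| = c * max 1 y := by
    rw [hyc, mul_max_of_nonneg _ _ (by positivity : (0 : ℝ) ≤ c), mul_one]
  rw [hm, hy2, div_mul_div_comm, mul_one, div_le_div_iff₀ (by positivity) (by positivity)]
  have h6 : 1 + (c * y) ^ 2 ≤ c ^ 2 * (1 + y ^ 2) := by nlinarith
  calc (c : ℝ) * max 1 y * ((c * Real.cos θ) ^ K * (1 + (c * y) ^ 2))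
      ≤ c * max 1 y * ((c * Real.cos θ) ^ K * (c ^ 2 * (1 + y ^ 2))) := by gcongr
    _ = c ^ 3 * (c * Real.cos θ) ^ K * (max 1 y * (1 + y ^ 2)) := by ring
    _ ≤ c ^ 3 * (c * Real.cos θ) ^ K * (26 / 10 * (1 + 79 / 1000 * y ^ 2) ^ 5) := by gcongr
    _ = 26 / 10 * c ^ 3 * ((1 + 79 / 1000 * y ^ 2) ^ 5 * (c * Real.cos θ) ^ K) := by ring
    _ ≤ _ := by gcongr

/-- Sharper decay at height `c = 1`. -/
lemma div_norm_latticePt_one_pow_le {θ : ℝ} {K : ℕ} (hK : 10 ≤ K)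
    (hs : 79 / 100 ≤ K * Real.sin θ ^ 2) (n : ℤ) (j : ℕ)
    (hj : |(1 : ℝ) + 2 * n| = 2 * (j + 1) + 1) :
    max (1 : ℝ) |(1 : ℝ) + 2 * n| / ‖latticePt θ 1 n‖ ^ K ≤
      5185 / 10000 * (1 / ((j + 1) * (j + 2))) := by
  obtain ⟨v, hv⟩ : ∃ v : ℝ, v = ((j : ℝ) + 1) * (j + 2) := ⟨_, rfl⟩
  have hj0 : (0 : ℝ) ≤ j := by positivity
  have hv2 : 2 ≤ v := by nlinarith
  rw [← hv]
  have h1 : (1 + K * (4 * v * Real.sin θ ^ 2) / 10) ^ 5 ≤ ‖latticePt θ 1 n‖ ^ K := by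
    refine one_add_pow_five_le_pow hK (by positivity) (by positivity) ?_
    rw [norm_latticePt_sq, mul_pow (_ + _), ← sq_abs (_ + _)]
    simp only [PNat.one_coe, Nat.cast_one, one_mul]
    rw [hj]
    have := Real.sin_sq_add_cos_sq θ
    nlinarith
  have h2 : (1 + 316 / 1000 * v) ^ 5 ≤ ‖latticePt θ 1 n‖ ^ K := by
    refine le_trans ?_ h1
    refine pow_le_pow_left₀ (by positivity) ?_ 5
    nlinarith
  have h3 : max (1 : ℝ) |(1 : ℝ) + 2 * n| ≤ v + 1 := by
    rw [hj]; apply max_le <;> nlinarith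
  have h4 : (v + 1) * v ≤ 5185 / 10000 * (1 + 316 / 1000 * v) ^ 5 := by
    clear h1 h2 h3 hv
    obtain ⟨u, rfl⟩ : ∃ u, v = u + 2 := ⟨v - 2, by ring⟩
    have hu : 0 ≤ u := by linarith
    nlinarith [pow_nonneg hu 2, pow_nonneg hu 3, pow_nonneg hu 4, pow_nonneg hu 5]
  rw [mul_one_div, div_le_div_iff₀ (lt_of_lt_of_le (by positivity) h2) (by positivity)]
  calc _ ≤ (v + 1) * v := by gcongr
    _ ≤ _ := h4
    _ ≤ _ := by gcongr

lemma hasSum_one_div_mul_succ :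
    HasSum (fun j : ℕ => 1 / (((j : ℝ) + 1) * (j + 2))) 1 := by
  rw [hasSum_iff_tendsto_nat_of_nonneg (fun j => by positivity)]
  have h : ∀ n : ℕ, ∑ j ∈ Finset.range n, 1 / (((j : ℝ) + 1) * (j + 2)) = 1 - 1 / ((n : ℝ) + 1) := by
    intro n
    induction n with
    | zero => simp
    | succ n ih => rw [Finset.sum_range_succ, ih]; push_cast; field_simp; ring
  simp_rw [h]
  simpa using tendsto_const_nhds.sub (tendsto_one_div_add_atTop_nhds_zero_nat (𝕜 := ℝ))

lemma summable_int_one_div_one_add_sq : Summable (fun l : ℤ => 1 / (1 + (l : ℝ) ^ 2)) ∧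
    ∑' l : ℤ, 1 / (1 + (l : ℝ) ^ 2) ≤ 7 / 2 := by
  have hb : ∀ j : ℕ, 1 / (1 + ((j : ℝ) + 1) ^ 2) ≤ 5 / 4 * (1 / (((j : ℝ) + 1) * (j + 2))) := by
    intro j
    rw [mul_one_div, div_le_div_iff₀ (by positivity) (by positivity)]
    nlinarith [sq_nonneg ((j : ℝ) - 1)]
  have hs := hasSum_one_div_mul_succ.mul_left (5 / 4)
  have h1 : Summable fun j : ℕ => 1 / (1 + ((j : ℝ) + 1) ^ 2) :=
    Summable.of_nonneg_of_le (fun j => by positivity) hb hs.summable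
  have h2 : ∑' j : ℕ, 1 / (1 + ((j : ℝ) + 1) ^ 2) ≤ 5 / 4 := by
    simpa using (h1.tsum_le_tsum hb hs.summable).trans_eq hs.tsum_eq
  have h3 : Summable fun j : ℕ => 1 / (1 + (((j : ℤ) : ℝ)) ^ 2) := by
    rw [← summable_nat_add_iff 1]; simpa using h1
  have h5 : (fun j : ℕ => 1 / (1 + (((-((j : ℤ) + 1) : ℤ) : ℝ)) ^ 2)) =
      fun j : ℕ => 1 / (1 + ((j : ℝ) + 1) ^ 2) := by
    funext j
    rw [Int.cast_neg, neg_sq]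
    push_cast
    rfl
  have h4 : Summable fun j : ℕ => 1 / (1 + (((-((j : ℤ) + 1) : ℤ) : ℝ)) ^ 2) := by
    rw [h5]; exact h1
  refine ⟨Summable.of_nat_of_neg_add_one h3 h4, ?_⟩
  have h6 := tsum_of_nat_of_neg_add_one (f := fun l : ℤ => 1 / (1 + (l : ℝ) ^ 2)) h3 h4
  rw [h5, h3.tsum_eq_zero_add] at h6
  push_cast at h6
  rw [h6]
  linarith

lemma summable_one_div_one_add_sq_arith (c : ℕ) :
    Summable (fun n : ℤ => 1 / (1 + ((c : ℝ) + 2 * n) ^ 2)) ∧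
    ∑' n : ℤ, 1 / (1 + ((c : ℝ) + 2 * n) ^ 2) ≤ 7 / 2 := by
  obtain ⟨h1, h2⟩ := summable_int_one_div_one_add_sq
  have hi : Function.Injective (fun n : ℤ => (c : ℤ) + 2 * n) := fun a b h => by
    simp only at h; omega
  have h3 := h1.comp_injective hi
  have h4 := tsum_comp_le_tsum_of_inj h1 (fun _ => by positivity) hi
  simp only [Function.comp_def] at h3 h4
  push_cast at h3 h4
  exact ⟨h3, h4.trans h2⟩

lemma cube_div_pow_le {x : ℝ} {K : ℕ} (hK : 11 ≤ K) (hx : √3 / 2 ≤ x) (i : ℕ) :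
    ((i : ℝ) + 2) ^ 3 / ((i + 2) * x) ^ K ≤ 487 / 12800 * (1 / (((i : ℝ) + 1) * (i + 2))) := by
  have h3 : (1.732 : ℝ) ≤ √3 := Real.le_sqrt_of_sq_le (by norm_num)
  have hi : (0 : ℝ) ≤ i := by positivity
  have hx1 : (0.866 : ℝ) ≤ x := by linarith
  have h5 : (1 : ℝ) ≤ (i + 2) * x := by nlinarith
  have h6 : ((i : ℝ) + 2) ^ 11 * (0.866 : ℝ) ^ 11 ≤ ((i + 2) * x) ^ K := by
    rw [← mul_pow]
    calc (((i : ℝ) + 2) * 0.866) ^ 11 ≤ ((i + 2) * x) ^ 11 := by gcongr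
      _ ≤ _ := pow_le_pow_right₀ h5 hK
  have h7 : 128 * ((i : ℝ) + 1) ≤ (i + 2) ^ 7 := by
    nlinarith [pow_nonneg hi 2, pow_nonneg hi 3, pow_nonneg hi 4, pow_nonneg hi 5,
      pow_nonneg hi 6, pow_nonneg hi 7]
  rw [mul_one_div, div_le_div_iff₀ (by positivity) (by positivity)]
  calc ((i : ℝ) + 2) ^ 3 * ((i + 1) * (i + 2)) = ((i : ℝ) + 2) ^ 4 * (128 * (i + 1)) / 128 := by ring
    _ ≤ ((i : ℝ) + 2) ^ 4 * (i + 2) ^ 7 / 128 := by gcongr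
    _ ≤ 487 / 12800 * (((i : ℝ) + 2) ^ 11 * (0.866 : ℝ) ^ 11) := by
      have : (0 : ℝ) ≤ (i + 2) ^ 11 := by positivity
      nlinarith
    _ ≤ _ := by gcongr

/-- A double sum over the lattice whose terms are dominated by `max c |c + 2 n| / ‖w‖ ^ K` is
close to the sum of its two leading terms. -/
lemma lattice_sum_near_main {θ : ℝ} {K : ℕ} (hK : 11 ≤ K) (hc : √3 / 2 ≤ Real.cos θ)
    (hs : 79 / 100 ≤ K * Real.sin θ ^ 2) {v : ℕ+ → ℤ → ℂ}
    (hv : ∀ c n, ‖v c n‖ ≤ max (c : ℝ) |(c : ℝ) + 2 * n| / ‖latticePt θ c n‖ ^ K) :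
    (∀ c, Summable (v c)) ∧ (Summable fun c => ∑' n, v c n) ∧
      ‖∑' c, ∑' n, v c n - (v 1 0 + v 1 (-1))‖ ≤ 7 / 5 := by
  have hc0 : 0 < Real.cos θ := lt_of_lt_of_le (by positivity) hc
  have hb : ∀ (c : ℕ+) (n : ℤ), ‖v c n‖ ≤
      26 / 10 * c ^ 3 / (c * Real.cos θ) ^ K * (1 / (1 + ((c : ℝ) + 2 * n) ^ 2)) := fun c n =>
    (hv c n).trans (max_div_norm_latticePt_pow_le (by omega) hc0 hs c n)
  have hin : ∀ c, Summable (v c) := fun c =>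
    Summable.of_norm_bounded ((summable_one_div_one_add_sq_arith c).1.mul_left _) (hb c)
  have hbd : ∀ i : ℕ, ‖∑' n, v (i + 1).succPNat n‖ ≤
      91 / 10 * (487 / 12800) * (1 / (((i : ℝ) + 1) * (i + 2))) := by
    intro i
    refine (tsum_of_norm_bounded
      ((summable_one_div_one_add_sq_arith _).1.hasSum.mul_left _) (hb _)).trans ?_
    have h1 := (summable_one_div_one_add_sq_arith (i + 1).succPNat).2
    have h2 := cube_div_pow_le hK hc i
    have h3 : (((i + 1).succPNat : ℕ) : ℝ) = i + 2 := by
      rw [Nat.succPNat_coe]; push_cast; ring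
    rw [h3] at h1 ⊢
    rw [mul_div_assoc]
    calc _ ≤ 26 / 10 * (487 / 12800 * (1 / (((i : ℝ) + 1) * (i + 2)))) * (7 / 2) := by gcongr
      _ = _ := by ring
  have hsb := hasSum_one_div_mul_succ.mul_left (91 / 10 * (487 / 12800))
  have hs2 : Summable fun i : ℕ => ∑' n, v (i + 1).succPNat n :=
    Summable.of_norm_bounded hsb.summable hbd
  have hs1 : Summable fun i : ℕ => ∑' n, v i.succPNat n := by
    rw [← summable_nat_add_iff 1]; exact hs2
  have hout : Summable fun c => ∑' n, v c n := by
    rw [← Equiv.pnatEquivNat.symm.summable_iff]; exact hs1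
  refine ⟨hin, hout, ?_⟩
  have e1 : ∑' c, ∑' n, v c n = ∑' n, v 1 n + ∑' i : ℕ, ∑' n, v (i + 1).succPNat n := by
    rw [← Equiv.pnatEquivNat.symm.tsum_eq]
    exact hs1.tsum_eq_zero_add
  have hpos : Summable fun j : ℕ => v 1 (j : ℤ) := (hin 1).comp_injective Nat.cast_injective
  have hneg : Summable fun j : ℕ => v 1 (-((j : ℤ) + 1)) :=
    (hin 1).comp_injective fun a b h => by omega
  have e2 : ∑' n, v 1 n = v 1 0 + v 1 (-1) + (∑' j : ℕ, v 1 ((j : ℤ) + 1) +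
      ∑' j : ℕ, v 1 (-((j : ℤ) + 1 + 1))) := by
    rw [tsum_of_nat_of_neg_add_one hpos hneg, hpos.tsum_eq_zero_add, hneg.tsum_eq_zero_add]
    push_cast
    ring
  have hs5 := hasSum_one_div_mul_succ.mul_left (5185 / 10000)
  have b1 : ‖∑' j : ℕ, v 1 ((j : ℤ) + 1)‖ ≤ 5185 / 10000 := by
    refine tsum_of_norm_bounded (by simpa using hs5) fun j => ?_
    refine (hv _ _).trans ?_
    have := div_norm_latticePt_one_pow_le (by omega : 10 ≤ K) hs ((j : ℤ) + 1) j (by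
      push_cast; rw [abs_of_pos (by positivity)]; ring)
    simpa using this
  have b2 : ‖∑' j : ℕ, v 1 (-((j : ℤ) + 1 + 1))‖ ≤ 5185 / 10000 := by
    refine tsum_of_norm_bounded (by simpa using hs5) fun j => ?_
    refine (hv _ _).trans ?_
    have := div_norm_latticePt_one_pow_le (by omega : 10 ≤ K) hs (-((j : ℤ) + 1 + 1)) j (by
      push_cast; rw [abs_of_neg (by have : (0 : ℝ) ≤ j := by positivity
                                    linarith)]; ring)
    simpa using this
  have b3 : ‖∑' i : ℕ, ∑' n, v (i + 1).succPNat n‖ ≤ 91 / 10 * (487 / 12800) :=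
    tsum_of_norm_bounded (by simpa using hsb) hbd
  rw [e1, e2, add_sub_right_comm, add_sub_cancel_left]
  calc _ ≤ _ := (norm_add_le _ _).trans (add_le_add_left (norm_add_le _ _) _)
    _ ≤ 5185 / 10000 + 5185 / 10000 + 91 / 10 * (487 / 12800) := by linarith
    _ ≤ _ := by norm_num

lemma latticePt_one_zero (θ : ℝ) : latticePt θ 1 0 = Complex.exp (-(θ * Complex.I)) := by
  apply Complex.ext <;>
    simp [latticePt, Complex.exp_re, Complex.exp_im]

lemma latticePt_one_neg_one (θ : ℝ) : latticePt θ 1 (-1) = Complex.exp (θ * Complex.I) := by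
  apply Complex.ext <;>
    simp [latticePt, Complex.exp_re, Complex.exp_im]
  ring

lemma latticePt_eq (θ : ℝ) (c : ℕ+) (n : ℤ) : latticePt θ c n =
    (c : ℂ) * Real.cos θ - Complex.I * ((c + 2 * n) * Real.sin θ) := by
  apply Complex.ext <;> simp [latticePt, -Complex.ofReal_cos, -Complex.ofReal_sin]

lemma latticePt_ne_zero {θ : ℝ} (h : 0 < Real.cos θ) (c : ℕ+) (n : ℤ) : latticePt θ c n ≠ 0 := by
  rw [← norm_pos_iff]
  have hc1 : (1 : ℝ) ≤ c := by exact_mod_cast c.pos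
  exact lt_of_lt_of_le (by positivity) (norm_latticePt_ge θ c n)

lemma realSeries_cot_eq (k p : ℕ) (hk : 2 ≤ k) {θ : ℝ} (h0 : 0 < Real.sin θ)
    (h1 : 0 < Real.cos θ) :
    (realSeries k p (Real.cot θ / 2) : ℂ) =
      ((((k - 1 + p).factorial : ℝ) * (Real.sin θ / Real.pi) ^ (k + p) : ℝ) : ℂ) *
        ∑' c : ℕ+, ∑' n : ℤ, (c : ℂ) ^ p / latticePt θ c n ^ (k + p) := by
  rw [← divSeries_half_add, divSeries_eq_lattice k p hk h0 h1]
  push_cast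
  rfl

lemma exists_realSeries_one_cot_eq {k : ℕ} (hk : 10 ≤ k) {θ : ℝ} (h0 : 0 < Real.sin θ)
    (hc : √3 / 2 ≤ Real.cos θ) (hs : 79 / 100 ≤ (k + 1 : ℕ) * Real.sin θ ^ 2) :
    ∃ U : ℝ, realSeries k 1 (Real.cot θ / 2) =
      (k.factorial : ℝ) * (Real.sin θ / Real.pi) ^ (k + 1) * U ∧
      |U - 2 * Real.cos ((k + 1 : ℕ) * θ)| ≤ 7 / 5 := by
  have h1 : 0 < Real.cos θ := lt_of_lt_of_le (by positivity) hc
  have hP : 0 < (k.factorial : ℝ) * (Real.sin θ / Real.pi) ^ (k + 1) := by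
    have := Real.pi_pos; positivity
  have hR := realSeries_cot_eq k 1 (by omega) h0 h1
  rw [show k - 1 + 1 = k by omega] at hR
  obtain ⟨-, -, h⟩ := lattice_sum_near_main (by omega : 11 ≤ k + 1) hc hs
    (v := fun c n => (c : ℂ) ^ 1 / latticePt θ c n ^ (k + 1)) (fun c n => by
      rw [norm_div, norm_pow, norm_pow, pow_one, Complex.norm_natCast]
      gcongr
      exact le_max_left _ _)
  refine ⟨realSeries k 1 (Real.cot θ / 2) / ((k.factorial : ℝ) *
    (Real.sin θ / Real.pi) ^ (k + 1)), by field_simp, ?_⟩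
  rw [← Real.norm_eq_abs, ← Complex.norm_real]
  refine le_of_eq_of_le ?_ h
  congr 1
  rw [Complex.ofReal_sub, Complex.ofReal_div, hR, mul_div_cancel_left₀ _ (by exact_mod_cast hP.ne')]
  congr 1
  rw [latticePt_one_zero, latticePt_one_neg_one, ← Complex.exp_nat_mul, ← Complex.exp_nat_mul,
    PNat.one_coe, Nat.cast_one, one_pow, one_div, one_div, ← Complex.exp_neg, ← Complex.exp_neg]
  push_cast
  rw [Complex.two_cos]
  ring_nf

lemma exists_realSeries_two_cot_eq {k : ℕ} (hk : 10 ≤ k) {θ : ℝ} (h0 : 0 < Real.sin θ)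
    (hc : √3 / 2 ≤ Real.cos θ) (hs : 79 / 100 ≤ (k + 1 : ℕ) * Real.sin θ ^ 2) :
    ∃ V : ℝ, Real.pi * realSeries k 2 (Real.cot θ / 2) -
        (k + 1 : ℕ) * Real.sin θ * Real.cos θ * realSeries k 1 (Real.cot θ / 2) =
      ((k + 1).factorial : ℝ) * Real.sin θ ^ (k + 3) / Real.pi ^ (k + 1) * V ∧
      |V + 2 * Real.sin ((k + 1 : ℕ) * θ)| ≤ 7 / 5 := by
  have h1 : 0 < Real.cos θ := lt_of_lt_of_le (by positivity) hc
  have hpi := Real.pi_pos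
  have hP : 0 < ((k + 1).factorial : ℝ) * Real.sin θ ^ (k + 3) / Real.pi ^ (k + 1) := by
    positivity
  have hR := realSeries_cot_eq k 1 (by omega) h0 h1
  have hR2 := realSeries_cot_eq k 2 (by omega) h0 h1
  rw [show k - 1 + 1 = k by omega] at hR
  rw [show k - 1 + 2 = k + 1 by omega] at hR2
  have hs0 : (Real.sin θ : ℂ) ≠ 0 := by exact_mod_cast h0.ne'
  have hsc : (Real.sin θ : ℂ) ^ 2 + (Real.cos θ : ℂ) ^ 2 = 1 := by
    exact_mod_cast Real.sin_sq_add_cos_sq θ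
  obtain ⟨i1, o1, -⟩ := lattice_sum_near_main (by omega : 11 ≤ k + 1) hc hs
    (v := fun c n => (c : ℂ) ^ 1 / latticePt θ c n ^ (k + 1)) (fun c n => by
      rw [norm_div, norm_pow, norm_pow, pow_one, Complex.norm_natCast]
      gcongr
      exact le_max_left _ _)
  obtain ⟨i2, o2, h⟩ := lattice_sum_near_main (by omega : 11 ≤ k + 1) hc hs
    (v := fun c n => (c : ℂ) * (c * Real.sin θ + Complex.I * ((c + 2 * n) * Real.cos θ)) /
      latticePt θ c n ^ (k + 2)) (fun c n => by
      have hw := norm_pos_iff.2 (latticePt_ne_zero h1 c n)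
      have hc1 : (1 : ℝ) ≤ c := by exact_mod_cast c.pos
      rw [norm_div, norm_pow, norm_mul, Complex.norm_natCast, pow_succ _ (k + 1),
        div_le_div_iff₀ (by positivity) (by positivity)]
      have key : c * ‖(c : ℂ) * Real.sin θ + Complex.I * ((c + 2 * n) * Real.cos θ)‖ ≤
          max (c : ℝ) |(c : ℝ) + 2 * n| * ‖latticePt θ c n‖ := by
        refine le_of_sq_le_sq ?_ (by positivity)
        rw [mul_pow, mul_pow, norm_latticePt_sq, ← Complex.normSq_eq_norm_sq]
        have e : Complex.normSq ((c : ℂ) * Real.sin θ + Complex.I * ((c + 2 * n) * Real.cos θ)) =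
            (c * Real.sin θ) ^ 2 + ((c + 2 * n) * Real.cos θ) ^ 2 := by
          rw [show (c : ℂ) * Real.sin θ + Complex.I * ((c + 2 * n) * Real.cos θ) =
            ((c * Real.sin θ : ℝ) : ℂ) + (((c + 2 * n) * Real.cos θ : ℝ) : ℂ) * Complex.I by
              push_cast; ring, Complex.normSq_add_mul_I]
        rw [e]
        have hcs : Real.sin θ ^ 2 ≤ Real.cos θ ^ 2 := by
          have := Real.sin_sq_add_cos_sq θ
          have h3 : (√3 / 2) ^ 2 = 3 / 4 := by rw [div_pow, Real.sq_sqrt (by norm_num)]; norm_num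
          have : (√3 / 2) ^ 2 ≤ Real.cos θ ^ 2 := by gcongr
          linarith
        generalize (c : ℝ) + 2 * n = y
        rcases le_total |y| c with hy | hy
        · rw [max_eq_left hy]
          have hy2 : y ^ 2 ≤ (c : ℝ) ^ 2 := by rw [← sq_abs]; gcongr
          refine mul_le_mul_of_nonneg_left ?_ (sq_nonneg _)
          nlinarith
        · rw [max_eq_right hy, sq_abs]
          have hy2 : (c : ℝ) ^ 2 ≤ y ^ 2 := by rw [← sq_abs y]; gcongr
          have hy4 : ((c : ℝ) ^ 2) ^ 2 ≤ (y ^ 2) ^ 2 := by gcongr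
          nlinarith [mul_le_mul_of_nonneg_right hy4 (sq_nonneg (Real.sin θ))]
      calc _ = c * ‖(c : ℂ) * Real.sin θ + Complex.I * ((c + 2 * n) * Real.cos θ)‖ *
            ‖latticePt θ c n‖ ^ (k + 1) := rfl
        _ ≤ max (c : ℝ) |(c : ℝ) + 2 * n| * ‖latticePt θ c n‖ * ‖latticePt θ c n‖ ^ (k + 1) := by
          gcongr
        _ = _ := by ring)
  have hterm : ∀ (c : ℕ+) (n : ℤ), (c : ℂ) ^ 2 / latticePt θ c n ^ (k + 2) =
      Real.cos θ * ((c : ℂ) ^ 1 / latticePt θ c n ^ (k + 1)) + Real.sin θ *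
      ((c : ℂ) * (c * Real.sin θ + Complex.I * ((c + 2 * n) * Real.cos θ)) /
      latticePt θ c n ^ (k + 2)) := by
    intro c n
    have hw := latticePt_ne_zero h1 c n
    have e : (c : ℂ) = Real.cos θ * latticePt θ c n +
        Real.sin θ * (c * Real.sin θ + Complex.I * ((c + 2 * n) * Real.cos θ)) := by
      rw [latticePt_eq]; linear_combination -(c : ℂ) * hsc
    rw [pow_succ _ (k + 1)]
    calc _ = (c : ℂ) * c / (latticePt θ c n ^ (k + 1) * latticePt θ c n) := by ring
      _ = (c : ℂ) * (Real.cos θ * latticePt θ c n +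
        Real.sin θ * (c * Real.sin θ + Complex.I * ((c + 2 * n) * Real.cos θ))) /
          (latticePt θ c n ^ (k + 1) * latticePt θ c n) := by rw [← e]
      _ = _ := by field_simp
  have hsum : ∑' c : ℕ+, ∑' n : ℤ, (c : ℂ) ^ 2 / latticePt θ c n ^ (k + 2) =
      Real.cos θ * ∑' c : ℕ+, ∑' n : ℤ, (c : ℂ) ^ 1 / latticePt θ c n ^ (k + 1) + Real.sin θ *
      ∑' c : ℕ+, ∑' n : ℤ, ((c : ℂ) * (c * Real.sin θ + Complex.I * ((c + 2 * n) * Real.cos θ)) /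
      latticePt θ c n ^ (k + 2)) := by
    rw [← tsum_mul_left, ← tsum_mul_left, ← (o1.mul_left _).tsum_add (o2.mul_left _)]
    refine tsum_congr fun c => ?_
    rw [← tsum_mul_left, ← tsum_mul_left, ← ((i1 c).mul_left _).tsum_add ((i2 c).mul_left _)]
    exact tsum_congr fun n => hterm c n
  refine ⟨(Real.pi * realSeries k 2 (Real.cot θ / 2) -
        (k + 1 : ℕ) * Real.sin θ * Real.cos θ * realSeries k 1 (Real.cot θ / 2)) /
      (((k + 1).factorial : ℝ) * Real.sin θ ^ (k + 3) / Real.pi ^ (k + 1)), by field_simp, ?_⟩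
  rw [← Real.norm_eq_abs, ← Complex.norm_real]
  refine le_of_eq_of_le ?_ h
  congr 1
  rw [Complex.ofReal_add, ← sub_neg_eq_add, Complex.ofReal_div, Complex.ofReal_sub,
    Complex.ofReal_mul, Complex.ofReal_mul _ (realSeries k 1 _), hR, hR2, hsum]
  congr 1
  · rw [div_eq_iff (by exact_mod_cast hP.ne'), Nat.factorial_succ]
    have hpi' : (Real.pi : ℂ) ≠ 0 := by exact_mod_cast hpi.ne'
    push_cast
    rw [div_pow, div_pow]
    field_simp
    ring
  have e1 : ((1 : ℂ) * Real.sin θ) + Complex.I * ((1 + 2 * (0 : ℤ)) * Real.cos θ) =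
      Complex.I * Complex.exp (-(θ * Complex.I)) := by
    rw [← neg_mul, Complex.exp_mul_I, Complex.cos_neg, Complex.sin_neg]
    push_cast
    linear_combination Complex.sin θ * Complex.I_sq
  have e2 : ((1 : ℂ) * Real.sin θ) + Complex.I * ((1 + 2 * (-1 : ℤ)) * Real.cos θ) =
      -Complex.I * Complex.exp (θ * Complex.I) := by
    rw [Complex.exp_mul_I]
    push_cast
    linear_combination Complex.sin θ * Complex.I_sq
  rw [latticePt_one_zero, latticePt_one_neg_one, PNat.one_coe, Nat.cast_one, one_mul, e1, e2,
    ← Complex.exp_nat_mul, ← Complex.exp_nat_mul, one_mul, mul_div_assoc, mul_div_assoc,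
    ← Complex.exp_sub, ← Complex.exp_sub]
  push_cast
  rw [Complex.two_sin]
  ring_nf

lemma existsUnique_zero_Ioo {f : ℝ → ℝ} {a b ε : ℝ} (hab : a < b)
    (hf : ContinuousOn f (Set.Icc a b)) (ha : ε * f a < 0) (hb : 0 < ε * f b)
    (hu : ∀ x y, a < x → x < y → y < b → f x = 0 → f y = 0 → False) :
    ∃! s, s ∈ Set.Ioo a b ∧ f s = 0 := by
  obtain ⟨s, hs, h0⟩ := intermediate_value_Ioo hab.le (continuousOn_const.mul hf :
    ContinuousOn (fun x => ε * f x) (Set.Icc a b)) ⟨ha, hb⟩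
  have hε : ε ≠ 0 := by rintro rfl; simp at ha
  have hs0 : f s = 0 := (mul_eq_zero.1 h0).resolve_left hε
  refine ⟨s, ⟨hs, hs0⟩, fun y hy => ?_⟩
  rcases lt_trichotomy y s with h | h | h
  · exact (hu y s hy.1.1 h hs.2 hy.2 hs0).elim
  · exact h
  · exact (hu s y hs.1 h hy.1.2 hs0 hy.2).elim

lemma Real.cot_lt_cot {x y : ℝ} (hx : 0 < x) (hxy : x < y) (hy : y < Real.pi / 2) :
    Real.cot y < Real.cot x := by
  have hsx := Real.sin_pos_of_pos_of_lt_pi hx (by linarith [Real.pi_pos])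
  have hsy := Real.sin_pos_of_pos_of_lt_pi (hx.trans hxy) (by linarith [Real.pi_pos])
  rw [Real.cot_eq_cos_div_sin, Real.cot_eq_cos_div_sin, div_lt_div_iff₀ hsy hsx]
  have := Real.sin_pos_of_pos_of_lt_pi (sub_pos.2 hxy) (by linarith [Real.pi_pos])
  rw [Real.sin_sub] at this
  linarith

lemma Real.cot_arctan_inv (s : ℝ) : Real.cot (Real.arctan s⁻¹) = s := by
  rw [← Real.tan_inv_eq_cot, Real.tan_arctan, inv_inv]

lemma continuousOn_realSeries (k p : ℕ) : ContinuousOn (realSeries k p) (Set.Ioi 0) :=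
  fun _ ht => (hasDerivAt_realSeries k p ht).continuousAt.continuousWithinAt

lemma le_mul_sin_sq {K m : ℕ} (hK : 11 ≤ K) (hKm : K ≤ 12 * m ^ 2) {θ : ℝ}
    (h1 : m * Real.pi / K ≤ θ) (h2 : θ ≤ Real.pi / 6) : 79 / 100 ≤ K * Real.sin θ ^ 2 := by
  have hpi := Real.pi_gt_d4
  have hpi' := Real.pi_lt_d4
  have hK0 : (11 : ℝ) ≤ K := by exact_mod_cast hK
  set x := Real.pi / √(12 * K) with hx
  have hx0 : 0 < x := by positivity
  have hx2 : K * x ^ 2 = Real.pi ^ 2 / 12 := by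
    rw [hx, div_pow, Real.sq_sqrt (by positivity)]; field_simp
  have hxα : x ≤ m * Real.pi / K := by
    refine le_of_sq_le_sq ?_ (by positivity)
    rw [hx, div_pow, Real.sq_sqrt (by positivity), div_pow, div_le_div_iff₀ (by positivity)
      (by positivity)]
    have : (K : ℝ) ≤ 12 * m ^ 2 := by exact_mod_cast hKm
    calc Real.pi ^ 2 * (K : ℝ) ^ 2 = Real.pi ^ 2 * K * K := by ring
      _ ≤ Real.pi ^ 2 * K * (12 * m ^ 2) := by gcongr
      _ = _ := by ring
  have hsin : x * (1 - x ^ 2 / 6) ≤ Real.sin θ := by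
    calc x * (1 - x ^ 2 / 6) = x - x ^ 3 / 6 := by ring
      _ ≤ Real.sin x := (Real.sin_gt_sub_cube hx0).le
      _ ≤ Real.sin θ := Real.sin_le_sin_of_le_of_le_pi_div_two (by linarith) (by linarith)
        (hxα.trans h1)
  have hpi2 : Real.pi ^ 2 ≤ 9.872 := by nlinarith
  have hpi3 : 9.868 ≤ Real.pi ^ 2 := by nlinarith
  have hxs : x ^ 2 ≤ 0.0748 := by nlinarith [sq_nonneg x]
  have h3 : 0.987 ≤ 1 - x ^ 2 / 6 := by linarith
  calc (79 / 100 : ℝ) ≤ K * x ^ 2 * 0.987 ^ 2 := by rw [hx2]; linarith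
    _ ≤ K * x ^ 2 * (1 - x ^ 2 / 6) ^ 2 := by gcongr
    _ = K * (x * (1 - x ^ 2 / 6)) ^ 2 := by ring
    _ ≤ _ := by gcongr

lemma hasDerivAt_realSeries_cot_div_sin_pow (k : ℕ) {θ : ℝ} (h0 : 0 < Real.sin θ)
    (h1 : 0 < Real.cos θ) :
    HasDerivAt (fun x => realSeries k 1 (Real.cot x / 2) / Real.sin x ^ (k + 1))
      ((Real.pi * realSeries k 2 (Real.cot θ / 2) -
        (k + 1 : ℕ) * Real.sin θ * Real.cos θ * realSeries k 1 (Real.cot θ / 2)) /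
        Real.sin θ ^ (k + 3)) θ := by
  have hcot : HasDerivAt (fun x => Real.cot x / 2) (-(1 / Real.sin θ ^ 2) / 2) θ := by
    have h := ((Real.hasDerivAt_cos θ).div (Real.hasDerivAt_sin θ) h0.ne').div_const 2
    have e : (fun x => Real.cot x / 2) = fun x => (Real.cos / Real.sin) x / 2 := by
      funext x; simp [Real.cot_eq_cos_div_sin]
    rw [e]
    convert! h using 1
    have := Real.sin_sq_add_cos_sq θ
    field_simp
    linarith
  have hpos : 0 < Real.cot θ / 2 := by rw [Real.cot_eq_cos_div_sin]; positivity
  have hr := (hasDerivAt_realSeries k 1 hpos).comp θ hcot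
  have h := hr.div ((Real.hasDerivAt_sin θ).pow (k + 1)) (pow_pos h0 _).ne'
  convert! h using 1
  simp only [Function.comp, Nat.add_sub_cancel, Pi.pow_apply]
  field_simp
  ring

lemma existsUnique_zero_of_lattice {k m : ℕ} (hk : 10 ≤ k) (hm : 1 ≤ m)
    (hkm : k + 1 ≤ 12 * m ^ 2) {β : ℝ} (hαβ : m * Real.pi / (k + 1 : ℕ) < β)
    (hβ6 : β ≤ Real.pi / 6) (hβm : β ≤ (m + 1) * Real.pi / (k + 1 : ℕ))
    (hβ : (-1) ^ m * Real.cos ((k + 1 : ℕ) * β) < -(7 / 10)) :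
    ∃! s, s ∈ Set.Ioo (Real.cot β / 2) (Real.cot (m * Real.pi / (k + 1 : ℕ)) / 2) ∧
      realSeries k 1 s = 0 := by
  have hpi := Real.pi_pos
  set α := m * Real.pi / (k + 1 : ℕ) with hα
  have hm0 : (0 : ℝ) < m := by exact_mod_cast hm
  have hK0 : (0 : ℝ) < (k + 1 : ℕ) := by positivity
  have hα0 : 0 < α := by positivity
  have hsin : ∀ θ, α ≤ θ → θ ≤ β → 0 < Real.sin θ := fun θ h1 h2 =>
    Real.sin_pos_of_pos_of_lt_pi (by linarith) (by linarith)
  have hcos : ∀ θ, α ≤ θ → θ ≤ β → √3 / 2 ≤ Real.cos θ := fun θ h1 h2 => by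
    rw [← Real.cos_pi_div_six]
    exact Real.cos_le_cos_of_nonneg_of_le_pi (by linarith) (by linarith) (by linarith)
  have hs2 : ∀ θ, α ≤ θ → θ ≤ β → 79 / 100 ≤ (k + 1 : ℕ) * Real.sin θ ^ 2 := fun θ h1 h2 =>
    le_mul_sin_sq (by omega) hkm h1 (by linarith)
  have hU : ∀ θ, α ≤ θ → θ ≤ β → _ := fun θ h1 h2 =>
    exists_realSeries_one_cot_eq hk (hsin θ h1 h2) (hcos θ h1 h2) (hs2 θ h1 h2)
  have hV : ∀ θ, α ≤ θ → θ ≤ β → _ := fun θ h1 h2 =>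
    exists_realSeries_two_cot_eq hk (hsin θ h1 h2) (hcos θ h1 h2) (hs2 θ h1 h2)
  have hε : ((-1 : ℝ)) ^ m * (-1) ^ m = 1 := by rw [← mul_pow]; simp
  have hεabs : |(-1 : ℝ) ^ m| = 1 := by simp
  have hcosm : ∀ θ, Real.cos ((k + 1 : ℕ) * θ - m * Real.pi) =
      (-1) ^ m * Real.cos ((k + 1 : ℕ) * θ) := fun θ => Real.cos_sub_nat_mul_pi _ _
  have hcot : ∀ θ, α ≤ θ → θ ≤ β → 0 < Real.cot θ := fun θ h1 h2 => by
    rw [Real.cot_eq_cos_div_sin]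
    exact div_pos (lt_of_lt_of_le (by positivity) (hcos θ h1 h2)) (hsin θ h1 h2)
  have hlt : Real.cot β / 2 < Real.cot α / 2 := by
    have := Real.cot_lt_cot hα0 hαβ (by linarith)
    linarith
  have hfac : 0 < (k.factorial : ℝ) := by positivity
  refine existsUnique_zero_Ioo (ε := (-1) ^ m) hlt ?_ ?_ ?_ ?_
  · refine (continuousOn_realSeries k 1).mono fun x hx => ?_
    have := hcot β hαβ.le le_rfl
    exact lt_of_lt_of_le (by positivity) hx.1
  · obtain ⟨U, hU1, hU2⟩ := hU β hαβ.le le_rfl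
    have hs := hsin β hαβ.le le_rfl
    rw [hU1]
    have h3 : |(-1) ^ m * U - 2 * ((-1) ^ m * Real.cos ((k + 1 : ℕ) * β))| ≤ 7 / 5 := by
      rw [show (-1) ^ m * U - 2 * ((-1) ^ m * Real.cos ((k + 1 : ℕ) * β)) =
        (-1) ^ m * (U - 2 * Real.cos ((k + 1 : ℕ) * β)) by ring, abs_mul, hεabs, one_mul]
      exact hU2
    have h4 : (-1) ^ m * U < 0 := by linarith [(abs_le.1 h3).2]
    have := mul_neg_of_pos_of_neg (mul_pos hfac (pow_pos (div_pos hs hpi) (k + 1))) h4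
    linarith
  · obtain ⟨U, hU1, hU2⟩ := hU α le_rfl hαβ.le
    have hs := hsin α le_rfl hαβ.le
    rw [hU1]
    have h1 : (-1) ^ m * Real.cos ((k + 1 : ℕ) * α) = 1 := by
      rw [← hcosm, hα, mul_div_cancel₀ _ hK0.ne', sub_self, Real.cos_zero]
    have h3 : |(-1) ^ m * U - 2 * ((-1) ^ m * Real.cos ((k + 1 : ℕ) * α))| ≤ 7 / 5 := by
      rw [show (-1) ^ m * U - 2 * ((-1) ^ m * Real.cos ((k + 1 : ℕ) * α)) =
        (-1) ^ m * (U - 2 * Real.cos ((k + 1 : ℕ) * α)) by ring, abs_mul, hεabs, one_mul]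
      exact hU2
    have h4 : 0 < (-1) ^ m * U := by linarith [(abs_le.1 h3).1]
    have := mul_pos (mul_pos hfac (pow_pos (div_pos hs hpi) (k + 1))) h4
    linarith
  · intro x y hx hxy hy hx0 hy0
    have hβ0 := hcot β hαβ.le le_rfl
    have hxp : 0 < x := by linarith
    have hex : ∀ s, Real.cot β / 2 < s → s < Real.cot α / 2 →
        ∃ θ, α < θ ∧ θ < β ∧ Real.cot θ / 2 = s := by
      intro s h1 h2
      have hs0 : 0 < 2 * s := by linarith
      have hc := Real.cot_arctan_inv (2 * s)
      have hθ0 : 0 < Real.arctan (2 * s)⁻¹ := Real.arctan_pos.2 (by positivity)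
      have hθ1 := Real.arctan_lt_pi_div_two (2 * s)⁻¹
      refine ⟨Real.arctan (2 * s)⁻¹, ?_, ?_, by rw [hc]; ring⟩
      · by_contra! h
        rcases h.lt_or_eq with h | h
        · have := Real.cot_lt_cot hθ0 h (by linarith)
          linarith
        · rw [h] at hc; linarith
      · by_contra! h
        rcases h.lt_or_eq with h | h
        · have := Real.cot_lt_cot (hα0.trans hαβ) h hθ1
          linarith
        · rw [← h] at hc; linarith
    obtain ⟨θx, hx1, hx2, rfl⟩ := hex x hx (hxy.trans hy)
    obtain ⟨θy, hy1, hy2, rfl⟩ := hex y (hx.trans hxy) hy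
    have hθ : θy < θx := by
      by_contra! h
      rcases h.lt_or_eq with h | h
      · have := Real.cot_lt_cot (hα0.trans hx1) h (by linarith)
        linarith
      · rw [h] at hxy; exact lt_irrefl _ hxy
    obtain ⟨ξ, hξ, hd⟩ := exists_hasDerivAt_eq_zero hθ
      (fun θ hθ => (hasDerivAt_realSeries_cot_div_sin_pow k
        (hsin θ (hy1.le.trans hθ.1) (hθ.2.trans hx2.le)) (lt_of_lt_of_le (by positivity)
        (hcos θ (hy1.le.trans hθ.1) (hθ.2.trans hx2.le)))).continuousAt.continuousWithinAt)
      (by simp only [hx0, hy0, zero_div])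
      (fun θ hθ => hasDerivAt_realSeries_cot_div_sin_pow k
        (hsin θ (hy1.le.trans hθ.1.le) (hθ.2.le.trans hx2.le)) (lt_of_lt_of_le (by positivity)
        (hcos θ (hy1.le.trans hθ.1.le) (hθ.2.le.trans hx2.le))))
    have hξ1 : α ≤ ξ := hy1.le.trans hξ.1.le
    have hξ2 : ξ ≤ β := hξ.2.le.trans hx2.le
    have hsξ := hsin ξ hξ1 hξ2
    obtain ⟨V, hV1, hV2⟩ := hV ξ hξ1 hξ2
    rw [hV1, div_eq_zero_iff] at hd
    have hV0 : V = 0 := by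
      have : 0 < ((k + 1).factorial : ℝ) := by positivity
      rcases hd with hd | hd
      · exact (mul_eq_zero.1 hd).resolve_left (by positivity)
      · exact absurd hd (by positivity)
    rw [hV0, zero_add, abs_mul, abs_two] at hV2
    have hzero : ∀ θ, α ≤ θ → θ ≤ β → realSeries k 1 (Real.cot θ / 2) = 0 →
        |Real.cos ((k + 1 : ℕ) * θ - m * Real.pi)| ≤ 7 / 10 := by
      intro θ h1 h2 h0
      obtain ⟨U, hU1, hU2⟩ := hU θ h1 h2
      have hs := hsin θ h1 h2
      rw [h0] at hU1
      have hU0 : U = 0 := (mul_eq_zero.1 hU1.symm).resolve_left (by positivity)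
      rw [hU0, zero_sub, abs_neg, abs_mul, abs_two] at hU2
      rw [hcosm, abs_mul, hεabs, one_mul]
      linarith
    have hcx := hzero θx hx1.le hx2.le hx0
    have hcy := hzero θy hy1.le hy2.le hy0
    have hlow : 0 ≤ (k + 1 : ℕ) * θy - m * Real.pi := by
      rw [hα, div_lt_iff₀ hK0] at hy1
      linarith
    have hhigh : (k + 1 : ℕ) * θx - m * Real.pi ≤ Real.pi := by
      rw [le_div_iff₀ hK0] at hβm
      nlinarith
    have e1 : (k + 1 : ℕ) * θy ≤ (k + 1 : ℕ) * ξ := by gcongr; exact hξ.1.le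
    have e2 : (k + 1 : ℕ) * ξ ≤ (k + 1 : ℕ) * θx := by gcongr; exact hξ.2.le
    have c1 := Real.cos_le_cos_of_nonneg_of_le_pi hlow (by linarith)
      (sub_le_sub_right e1 (m * Real.pi))
    have c2 := Real.cos_le_cos_of_nonneg_of_le_pi (by linarith) hhigh
      (sub_le_sub_right e2 (m * Real.pi))
    have hcξ : |Real.cos ((k + 1 : ℕ) * ξ)| ≤ 7 / 10 := by
      have : |Real.cos ((k + 1 : ℕ) * ξ - m * Real.pi)| ≤ 7 / 10 :=
        abs_le.2 ⟨(abs_le.1 hcx).1.trans c2, c1.trans (abs_le.1 hcy).2⟩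
      rwa [hcosm, abs_mul, hεabs, one_mul] at this
    have q1 := Real.sin_sq_add_cos_sq ((k + 1 : ℕ) * ξ)
    have q2 := abs_le.1 hcξ
    have q3 := abs_le.1 (show |Real.sin ((k + 1 : ℕ) * ξ)| ≤ 7 / 10 by linarith)
    nlinarith

lemma one_sub_mul_sum_range_succ_le {c : ℕ → ℝ} {ρ : ℝ} {M : ℕ} (h0 : 0 ≤ c 0) (hρ : 0 ≤ ρ)
    (h : ∀ n < M, c n ≤ ρ * c (n + 1)) :
    (1 - ρ) * ∑ n ∈ Finset.range (M + 1), c n ≤ c M := by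
  induction M with
  | zero => simp; nlinarith
  | succ M ih =>
    rw [Finset.sum_range_succ, mul_add]
    linarith [ih fun n hn => h n (by omega), h M (by omega)]

lemma tsum_nat_add_le_of_ratio {c : ℕ → ℝ} {ρ : ℝ} {M : ℕ} (h0 : ∀ n, 0 ≤ c n) (hρ : 0 ≤ ρ)
    (hρ1 : ρ < 1) (h : ∀ n, M ≤ n → c (n + 1) ≤ ρ * c n) :
    ∑' i, c (i + M) ≤ c M / (1 - ρ) := by
  have hb : ∀ i, c (i + M) ≤ c M * ρ ^ i := by
    intro i
    induction i with
    | zero => simp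
    | succ i ih =>
      calc c (i + 1 + M) = c (i + M + 1) := by ring_nf
        _ ≤ ρ * c (i + M) := h _ (by omega)
        _ ≤ ρ * (c M * ρ ^ i) := by gcongr
        _ = _ := by ring
  have hg := (hasSum_geometric_of_lt_one hρ hρ1).mul_left (c M)
  rw [div_eq_mul_inv, ← hg.tsum_eq]
  exact (Summable.of_nonneg_of_le (fun i => h0 _) hb hg.summable).tsum_le_tsum hb hg.summable

lemma summable_neg_one_pow_mul {b : ℕ → ℝ} (hs : Summable b) (h0 : ∀ n, 0 ≤ b n) :
    Summable fun n => (-1) ^ n * b n :=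
  Summable.of_norm_bounded hs fun n => by simp [abs_of_nonneg (h0 n)]

lemma abs_sum_neg_one_pow_mul_le {b : ℕ → ℝ} (h0 : ∀ n, 0 ≤ b n) (s : Finset ℕ) :
    |∑ n ∈ s, (-1) ^ n * b n| ≤ ∑ n ∈ s, b n :=
  (Finset.abs_sum_le_sum_abs _ _).trans_eq
    (Finset.sum_congr rfl fun n _ => by simp [abs_mul, abs_of_nonneg (h0 n)])

lemma abs_tsum_neg_one_pow_mul_le {b : ℕ → ℝ} (hs : Summable b) (h0 : ∀ n, 0 ≤ b n) (M : ℕ) :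
    |∑' i, (-1) ^ (i + M) * b (i + M)| ≤ ∑' i, b (i + M) := by
  rw [← Real.norm_eq_abs]
  exact tsum_of_norm_bounded ((summable_nat_add_iff M).2 hs).hasSum fun i => by
    simp [abs_of_nonneg (h0 _)]

/-- The sign of an alternating sum with a dominant term. -/
lemma neg_one_pow_mul_tsum_pos {b : ℕ → ℝ} (hs : Summable b) (h0 : ∀ n, 0 ≤ b n) {M : ℕ}
    (h : ∑ n ∈ Finset.range M, b n + ∑' i, b (i + (M + 1)) < b M) :
    0 < (-1) ^ M * ∑' n, (-1) ^ n * b n := by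
  have h1 := (summable_neg_one_pow_mul hs h0).sum_add_tsum_nat_add (M + 1)
  rw [Finset.sum_range_succ] at h1
  rw [← h1, mul_add, mul_add, ← mul_assoc _ _ (b M), ← mul_pow]
  have h2 := abs_sum_neg_one_pow_mul_le h0 (Finset.range M)
  have h3 := abs_tsum_neg_one_pow_mul_le hs h0 (M + 1)
  have hε : |(-1 : ℝ) ^ M| = 1 := by simp
  have h4 := neg_abs_le ((-1) ^ M * ∑ n ∈ Finset.range M, (-1) ^ n * b n)
  have h5 := neg_abs_le ((-1) ^ M * ∑' i, (-1) ^ (i + (M + 1)) * b (i + (M + 1)))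
  rw [abs_mul, hε, one_mul] at h4 h5
  norm_num
  linarith

/-- The weighted alternating sum `∑ (λ - n) (-1) ^ n b n` with `λ` between `m` and `m + 1` does
not vanish if the terms `m` and `m + 1`, which have the same sign, dominate. -/
lemma tsum_sub_mul_neg_one_pow_ne_zero {b : ℕ → ℝ} (hs : Summable fun n : ℕ => n * b n)
    (hs' : Summable b) (h0 : ∀ n, 0 ≤ b n) {m : ℕ} (hpos : 0 < b (m + 1))
    (hlow : ∀ n < m, b n ≤ 1 / 100 * b (n + 1))
    (hup : b (m + 2) ≤ 39 / 100 * b (m + 1))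
    (hup' : ∀ n, m + 2 ≤ n → b (n + 1) ≤ 105 / 1000 * b n) :
    ∑' n : ℕ, ((m + 1 / 10 : ℝ) - n) * ((-1) ^ n * b n) ≠ 0 := by
  set c : ℕ → ℝ := fun n => |(m + 1 / 10 : ℝ) - n| * b n with hc
  have hc0 : ∀ n, 0 ≤ c n := fun n => mul_nonneg (abs_nonneg _) (h0 n)
  have hsa : Summable fun n : ℕ => ((m + 1 / 10 : ℝ) - n) * ((-1) ^ n * b n) := by
    refine Summable.of_norm_bounded ((hs'.mul_left (m + 1 / 10 : ℝ)).add hs) fun n => ?_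
    rw [norm_mul, norm_mul, norm_pow, norm_neg, norm_one, one_pow, one_mul, Real.norm_eq_abs,
      Real.norm_eq_abs, abs_of_nonneg (h0 n), ← add_mul]
    gcongr
    · exact h0 n
    · refine (abs_sub _ _).trans ?_
      rw [abs_of_nonneg (by positivity), abs_of_nonneg (by positivity)]
  have habs : ∀ n : ℕ, |((m + 1 / 10 : ℝ) - n) * ((-1) ^ n * b n)| = c n := fun n => by
    simp [hc, abs_mul, abs_of_nonneg (h0 n)]
  have hsc : Summable c := by simpa only [habs] using hsa.abs
  have hcm : c m = 1 / 10 * b m := by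
    simp only [hc]; rw [add_sub_cancel_left, abs_of_pos (by norm_num)]
  have hcm1 : c (m + 1) = 9 / 10 * b (m + 1) := by
    simp only [hc]; push_cast; rw [abs_of_neg (by linarith)]; ring
  have hcm2 : c (m + 2) = 19 / 10 * b (m + 2) := by
    simp only [hc]; push_cast; rw [abs_of_neg (by linarith)]; ring
  have hL : ∀ n < m, c n ≤ 11 / 100 * c (n + 1) := by
    intro n hn
    have hn' : (n : ℝ) + 1 ≤ m := by exact_mod_cast hn
    simp only [hc]
    push_cast
    rw [abs_of_pos (by linarith), abs_of_pos (by linarith)]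
    nlinarith [hlow n hn, h0 (n + 1), h0 n, mul_le_mul_of_nonneg_left (hlow n hn)
      (by linarith : (0 : ℝ) ≤ m + 1 / 10 - n), mul_nonneg (h0 (n + 1)) (sub_nonneg.2 hn')]
  have hR : ∀ n, m + 2 ≤ n → c (n + 1) ≤ 161 / 1000 * c n := by
    intro n hn
    have hn' : (m : ℝ) + 2 ≤ n := by exact_mod_cast hn
    simp only [hc]
    push_cast
    rw [abs_of_neg (by linarith), abs_of_neg (by linarith)]
    nlinarith [hup' n hn, h0 (n + 1), h0 n, mul_le_mul_of_nonneg_left (hup' n hn)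
      (by linarith : (0 : ℝ) ≤ n + 1 - m - 1 / 10), mul_nonneg (h0 n) (sub_nonneg.2 hn')]
  have hhead := one_sub_mul_sum_range_succ_le (hc0 0) (by norm_num) hL
  rw [Finset.sum_range_succ] at hhead
  have htail := tsum_nat_add_le_of_ratio hc0 (by norm_num) (by norm_num) hR
  have h1 := hsa.sum_add_tsum_nat_add (m + 2)
  rw [Finset.sum_range_succ, Finset.sum_range_succ] at h1
  have hε : |(-1 : ℝ) ^ m| = 1 := by simp
  have hε2 : (-1 : ℝ) ^ m * (-1) ^ m = 1 := by rw [← mul_pow]; simp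
  have h2 : |∑ n ∈ Finset.range m, ((m + 1 / 10 : ℝ) - n) * ((-1) ^ n * b n)| ≤
      ∑ n ∈ Finset.range m, c n :=
    (Finset.abs_sum_le_sum_abs _ _).trans_eq (Finset.sum_congr rfl fun n _ => habs n)
  have h3 : |∑' i : ℕ, ((m + 1 / 10 : ℝ) - (i + (m + 2) : ℕ)) *
      ((-1) ^ (i + (m + 2)) * b (i + (m + 2)))| ≤ ∑' i, c (i + (m + 2)) := by
    rw [← Real.norm_eq_abs]
    exact tsum_of_norm_bounded ((summable_nat_add_iff (m + 2)).2 hsc).hasSum fun i => (habs _).le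
  have h4 := neg_abs_le ((-1) ^ m *
    ∑ n ∈ Finset.range m, ((m + 1 / 10 : ℝ) - n) * ((-1) ^ n * b n))
  have h5 := neg_abs_le ((-1) ^ m * ∑' i : ℕ, ((m + 1 / 10 : ℝ) - (i + (m + 2) : ℕ)) *
      ((-1) ^ (i + (m + 2)) * b (i + (m + 2))))
  rw [abs_mul, hε, one_mul] at h4 h5
  intro hzero
  rw [hzero] at h1
  have h6 := congrArg (fun x => (-1 : ℝ) ^ m * x) h1
  simp only [mul_zero, mul_add] at h6
  have t1 : (-1 : ℝ) ^ m * (((m + 1 / 10 : ℝ) - m) * ((-1) ^ m * b m)) = 1 / 10 * b m := by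
    linear_combination (1 / 10 * b m) * hε2
  have t2 : (-1 : ℝ) ^ m * (((m + 1 / 10 : ℝ) - (m + 1 : ℕ)) * ((-1) ^ (m + 1) * b (m + 1))) =
      9 / 10 * b (m + 1) := by
    push_cast
    rw [pow_succ]
    linear_combination (9 / 10 * b (m + 1)) * hε2
  rw [t1, t2] at h6
  rw [hcm] at hhead
  rw [hcm2] at htail
  norm_num at htail
  have := h0 m
  linarith

/-- The absolute value of the `n`-th term of the Fourier series of `E_k'` at `1 / 2 + i t`, up to
normalization. -/
noncomputable def fourierTerm (k : ℕ) (t : ℝ) (n : ℕ) : ℝ :=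
  n * (∑ d ∈ n.divisors, (d : ℝ) ^ (k - 1)) * Real.exp (-(2 * Real.pi * t)) ^ n

lemma fourierTerm_nonneg (k : ℕ) (t : ℝ) (n : ℕ) : 0 ≤ fourierTerm k t n := by
  unfold fourierTerm; positivity

lemma summable_pow_mul_fourierTerm (k p : ℕ) {t : ℝ} (ht : 0 < t) :
    Summable fun n : ℕ => (n : ℝ) ^ p * fourierTerm k t n := by
  refine (summable_realSeries k (p + 1) ht).abs.congr fun n => ?_
  rw [fourierTerm, abs_mul, abs_pow, abs_neg, abs_of_pos (Real.exp_pos _),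
    abs_of_nonneg (by positivity)]
  ring

lemma realSeries_eq_tsum_fourierTerm (k p : ℕ) (t : ℝ) :
    realSeries k (p + 1) t = ∑' n : ℕ, (n : ℝ) ^ p * ((-1) ^ n * fourierTerm k t n) := by
  rw [realSeries]
  refine tsum_congr fun n => ?_
  rw [fourierTerm, neg_pow]
  ring

lemma sum_one_div_pow_eleven_le (n : ℕ) :
    ∑ d ∈ Finset.Icc 1 (n + 1), 1 / (d : ℝ) ^ 11 ≤ 1 + 1 / 512 * (1 - 1 / ((n : ℝ) + 1)) := by
  induction n with
  | zero => norm_num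
  | succ n ih =>
    rw [Finset.sum_Icc_succ_top (by omega)]
    have h : 1 / ((n + 1 + 1 : ℕ) : ℝ) ^ 11 ≤ 1 / 512 * (1 / ((n : ℝ) + 1) - 1 / (n + 1 + 1)) := by
      have hn : (0 : ℝ) ≤ n := by positivity
      have h2 : (2 : ℝ) ^ 9 ≤ (n + 2) ^ 9 := by gcongr; linarith
      have e : 1 / 512 * (1 / ((n : ℝ) + 1) - 1 / (n + 1 + 1)) =
          1 / (2 ^ 9 * ((n + 1) * (n + 2))) := by
        field_simp; ring
      rw [e]
      refine one_div_le_one_div_of_le (by positivity) ?_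
      calc (2 : ℝ) ^ 9 * ((n + 1) * (n + 2)) ≤ (n + 2) ^ 9 * ((n + 2) * (n + 2)) := by
            gcongr; linarith
        _ = _ := by push_cast; ring
    push_cast at h ⊢
    linarith

lemma sum_divisors_pow_le {k : ℕ} (hk : 12 ≤ k) (n : ℕ) :
    ∑ d ∈ n.divisors, (d : ℝ) ^ (k - 1) ≤ 101 / 100 * (n : ℝ) ^ (k - 1) := by
  rcases Nat.eq_zero_or_pos n with rfl | hn
  · simp [show k - 1 ≠ 0 by omega]
  have hn' : (0 : ℝ) < n := by exact_mod_cast hn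
  rw [← Nat.sum_div_divisors n (fun d => (d : ℝ) ^ (k - 1))]
  calc ∑ d ∈ n.divisors, (((n / d : ℕ) : ℝ)) ^ (k - 1)
      ≤ ∑ d ∈ n.divisors, (n : ℝ) ^ (k - 1) * (1 / (d : ℝ) ^ 11) := by
        refine Finset.sum_le_sum fun d hd => ?_
        have hd0 : 1 ≤ d := Nat.pos_of_mem_divisors hd
        have hd1 : (1 : ℝ) ≤ d := by exact_mod_cast hd0
        rw [Nat.cast_div (Nat.dvd_of_mem_divisors hd) (by positivity), div_pow, mul_one_div]
        gcongr
        omega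
    _ ≤ ∑ d ∈ Finset.Icc 1 (n - 1 + 1), (n : ℝ) ^ (k - 1) * (1 / (d : ℝ) ^ 11) := by
        refine Finset.sum_le_sum_of_subset_of_nonneg (fun d hd => ?_) fun _ _ _ => by positivity
        rw [Finset.mem_Icc]
        have := Nat.pos_of_mem_divisors hd
        have := Nat.divisor_le hd
        omega
    _ ≤ _ := by
        rw [← Finset.mul_sum, mul_comm]
        gcongr
        refine (sum_one_div_pow_eleven_le (n - 1)).trans ?_
        have : (0 : ℝ) ≤ 1 / ((n - 1 : ℕ) + 1) := by positivity
        linarith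

lemma fourierTerm_le {k : ℕ} (hk : 12 ≤ k) (t : ℝ) (n : ℕ) :
    fourierTerm k t n ≤ 101 / 100 * ((n : ℝ) ^ k * Real.exp (-(2 * Real.pi * t)) ^ n) := by
  rw [fourierTerm]
  calc _ ≤ n * (101 / 100 * (n : ℝ) ^ (k - 1)) * Real.exp (-(2 * Real.pi * t)) ^ n := by
        gcongr; exact sum_divisors_pow_le hk n
    _ = _ := by
      obtain ⟨j, rfl⟩ : ∃ j, k = j + 1 := ⟨k - 1, by omega⟩
      rw [Nat.add_sub_cancel]; ring

lemma le_fourierTerm {k : ℕ} (hk : 12 ≤ k) (t : ℝ) (n : ℕ) :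
    (n : ℝ) ^ k * Real.exp (-(2 * Real.pi * t)) ^ n ≤ fourierTerm k t n := by
  rcases Nat.eq_zero_or_pos n with rfl | hn
  · simp [fourierTerm, show k ≠ 0 by omega]
  obtain ⟨j, rfl⟩ : ∃ j, k = j + 1 := ⟨k - 1, by omega⟩
  rw [fourierTerm, pow_succ', Nat.add_sub_cancel]
  gcongr
  exact Finset.single_le_sum (f := fun d : ℕ => (d : ℝ) ^ j) (fun _ _ => by positivity)
    (Nat.mem_divisors_self n hn.ne')

lemma fourierTerm_pos {k : ℕ} (hk : 12 ≤ k) (t : ℝ) {n : ℕ} (hn : 1 ≤ n) :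
    0 < fourierTerm k t n :=
  lt_of_lt_of_le (by positivity) (le_fourierTerm hk t n)

lemma fourierTerm_le_succ {k : ℕ} (hk : 12 ≤ k) {t ρ : ℝ} (hρ : 0 ≤ ρ) {n : ℕ}
    (h : 101 / 100 * (n : ℝ) ^ k ≤ ρ * ((n + 1 : ℝ) ^ k * Real.exp (-(2 * Real.pi * t)))) :
    fourierTerm k t n ≤ ρ * fourierTerm k t (n + 1) := by
  set x := Real.exp (-(2 * Real.pi * t)) with hx
  have hx0 : 0 < x := Real.exp_pos _
  calc fourierTerm k t n ≤ 101 / 100 * ((n : ℝ) ^ k * x ^ n) := fourierTerm_le hk t n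
    _ = 101 / 100 * (n : ℝ) ^ k * x ^ n := by ring
    _ ≤ ρ * ((n + 1 : ℝ) ^ k * x) * x ^ n := by gcongr
    _ = ρ * (((n + 1 : ℕ) : ℝ) ^ k * x ^ (n + 1)) := by push_cast; ring
    _ ≤ _ := by gcongr; exact le_fourierTerm hk t (n + 1)

lemma fourierTerm_succ_le {k : ℕ} (hk : 12 ≤ k) {t ρ : ℝ} (hρ : 0 ≤ ρ) {n : ℕ}
    (h : 101 / 100 * ((n + 1 : ℝ) ^ k * Real.exp (-(2 * Real.pi * t))) ≤ ρ * (n : ℝ) ^ k) :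
    fourierTerm k t (n + 1) ≤ ρ * fourierTerm k t n := by
  set x := Real.exp (-(2 * Real.pi * t)) with hx
  have hx0 : 0 < x := Real.exp_pos _
  calc fourierTerm k t (n + 1) ≤ 101 / 100 * (((n + 1 : ℕ) : ℝ) ^ k * x ^ (n + 1)) :=
        fourierTerm_le hk t (n + 1)
    _ = 101 / 100 * ((n + 1 : ℝ) ^ k * x) * x ^ n := by push_cast; ring
    _ ≤ ρ * (n : ℝ) ^ k * x ^ n := by gcongr
    _ = ρ * ((n : ℝ) ^ k * x ^ n) := by ring
    _ ≤ _ := by gcongr; exact le_fourierTerm hk t n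

lemma one_sub_le_exp_neg_sub {y : ℝ} (h0 : 0 ≤ y) (h1 : y < 1) :
    1 - y ≤ Real.exp (-y - y ^ 2 / 2) := by
  rw [← Real.log_le_iff_le_exp (by linarith)]
  have h := sum_le_hasSum (Finset.range 2) (fun n _ => by positivity)
    (Real.hasSum_pow_div_log_of_abs_lt_one (abs_lt.2 ⟨by linarith, h1⟩))
  norm_num [Finset.sum_range_succ] at h
  linarith

lemma one_add_le_exp_cubic {y : ℝ} (h0 : 0 ≤ y) :
    1 + y ≤ Real.exp (y - y ^ 2 / 2 + y ^ 3 / 3) := by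
  rw [← Real.log_le_iff_le_exp (by linarith)]
  have hd : ∀ x : ℝ, 0 ≤ x → HasDerivAt
      (fun x : ℝ => x - x ^ 2 / 2 + x ^ 3 / 3 - Real.log (1 + x)) (x ^ 3 / (1 + x)) x := by
    intro x hx
    have h := ((((hasDerivAt_id' x).sub ((hasDerivAt_pow 2 x).div_const 2)).add
      ((hasDerivAt_pow 3 x).div_const 3)).sub
      (((hasDerivAt_id' x).const_add 1).log (by positivity)))
    refine h.congr_deriv ?_
    field_simp
    norm_num
    ring
  have hmono := monotoneOn_of_deriv_nonneg (convex_Ici (0 : ℝ))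
    (fun x hx => (hd x hx).continuousAt.continuousWithinAt)
    (fun x hx => (hd x (interior_subset hx)).differentiableAt.differentiableWithinAt)
    (fun x hx => by
      have hx0 : (0 : ℝ) ≤ x := interior_subset hx
      rw [(hd x hx0).deriv]
      positivity)
  have h := hmono (Set.mem_Ici.2 le_rfl) (Set.mem_Ici.2 h0) h0
  norm_num at h
  linarith

/-- Ratio of consecutive terms below the dominant index. -/
lemma fourierTerm_le_exp_mul_succ {k : ℕ} (hk : 12 ≤ k) {t : ℝ} {n N : ℕ} (hnN : n + 1 ≤ N)
    (ht : 2 * Real.pi * t ≤ (k + 1) / N) :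
    fourierTerm k t n ≤ 101 / 100 * Real.exp (1 / N - k / (2 * N ^ 2)) * fourierTerm k t (n + 1) := by
  have hN : (1 : ℝ) ≤ N := by exact_mod_cast (by omega : 1 ≤ N)
  have hn : (n : ℝ) + 1 ≤ N := by exact_mod_cast hnN
  refine fourierTerm_le_succ hk (by positivity) ?_
  have hratio : (n : ℝ) ≤ (n + 1) * (1 - 1 / N) := by
    rw [mul_sub, mul_one, mul_one_div]
    have : ((n : ℝ) + 1) / N ≤ 1 := by rw [div_le_one (by linarith)]; exact hn
    linarith
  rcases eq_or_lt_of_le hN with hN1 | hN1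
  · have hn0 : n = 0 := by
      have : N = 1 := by exact_mod_cast hN1.symm
      omega
    rw [hn0, Nat.cast_zero, zero_pow (by omega), mul_zero]
    positivity
  have hy1 : 1 / (N : ℝ) < 1 := by rw [div_lt_one (by linarith)]; exact hN1
  have hexp := one_sub_le_exp_neg_sub (by positivity : 0 ≤ 1 / (N : ℝ)) hy1
  calc 101 / 100 * (n : ℝ) ^ k ≤ 101 / 100 * ((n + 1) * (1 - 1 / N)) ^ k := by gcongr
    _ ≤ 101 / 100 * ((n + 1) * Real.exp (-(1 / N) - (1 / N) ^ 2 / 2)) ^ k := by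
      have : (0 : ℝ) ≤ 1 - 1 / N := by linarith
      gcongr
    _ = 101 / 100 * ((n + 1 : ℝ) ^ k * Real.exp (k * (-(1 / N) - (1 / N) ^ 2 / 2))) := by
      rw [mul_pow, Real.exp_nat_mul]
    _ = 101 / 100 * Real.exp (1 / N - k / (2 * N ^ 2)) *
        ((n + 1 : ℝ) ^ k * Real.exp (-((k + 1) / N))) := by
      have : (k : ℝ) * (-(1 / N) - (1 / N) ^ 2 / 2) =
        (1 / N - k / (2 * N ^ 2)) + -((k + 1) / N) := by field_simp; ring
      rw [this, Real.exp_add]; ring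
    _ ≤ _ := by gcongr

/-- Ratio of consecutive terms at and above the dominant index. -/
lemma fourierTerm_succ_le_exp_mul {k : ℕ} (hk : 12 ≤ k) {t : ℝ} {N : ℕ} (hN : 1 ≤ N) {E : ℝ}
    (ht : k / N - k / (2 * N ^ 2) + k / (3 * N ^ 3) + E ≤ 2 * Real.pi * t) :
    fourierTerm k t (N + 1) ≤ 101 / 100 * Real.exp (-E) * fourierTerm k t N ∧
    ∀ n, N + 1 ≤ n → fourierTerm k t (n + 1) ≤
      101 / 100 * Real.exp (-E - k / (N + 1) ^ 2) * fourierTerm k t n := by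
  have hN' : (1 : ℝ) ≤ N := by exact_mod_cast hN
  have hone : (1 + 1 / (N : ℝ)) ^ k * Real.exp (-(2 * Real.pi * t)) ≤ Real.exp (-E) := by
    have h := one_add_le_exp_cubic (by positivity : 0 ≤ 1 / (N : ℝ))
    calc _ ≤ Real.exp (1 / N - (1 / N) ^ 2 / 2 + (1 / N) ^ 3 / 3) ^ k *
          Real.exp (-(2 * Real.pi * t)) := by gcongr
      _ ≤ _ := by
        rw [← Real.exp_nat_mul, ← Real.exp_add, Real.exp_le_exp]
        have : (k : ℝ) * (1 / N - (1 / N) ^ 2 / 2 + (1 / N) ^ 3 / 3) =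
          k / N - k / (2 * N ^ 2) + k / (3 * N ^ 3) := by field_simp
        linarith
  constructor
  · refine fourierTerm_succ_le hk (by positivity) ?_
    calc 101 / 100 * ((N + 1 : ℝ) ^ k * Real.exp (-(2 * Real.pi * t)))
        = 101 / 100 * ((1 + 1 / (N : ℝ)) ^ k * Real.exp (-(2 * Real.pi * t))) * N ^ k := by
          rw [show (N + 1 : ℝ) = (1 + 1 / N) * N by field_simp, mul_pow]; ring
      _ ≤ _ := by gcongr
  · intro n hn
    have hn' : (N : ℝ) + 1 ≤ n := by exact_mod_cast hn
    refine fourierTerm_succ_le hk (by positivity) ?_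
    have hratio : (n : ℝ) + 1 ≤ n * ((1 + 1 / N) * (1 - 1 / (N + 1) ^ 2)) := by
      have e : (1 + 1 / (N : ℝ)) * (1 - 1 / (N + 1) ^ 2) = 1 + 1 / (N + 1) := by
        field_simp; ring
      rw [e, mul_add, mul_one, mul_one_div]
      have : 1 ≤ (n : ℝ) / (N + 1) := by rw [le_div_iff₀ (by linarith)]; linarith
      linarith
    have hq : 1 - 1 / ((N : ℝ) + 1) ^ 2 ≤ Real.exp (-(1 / (N + 1) ^ 2)) :=
      Real.one_sub_le_exp_neg _
    have hq0 : (0 : ℝ) ≤ 1 - 1 / (N + 1) ^ 2 := by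
      rw [sub_nonneg, div_le_one (by positivity)]; nlinarith
    calc 101 / 100 * ((n + 1 : ℝ) ^ k * Real.exp (-(2 * Real.pi * t)))
        ≤ 101 / 100 * ((n * ((1 + 1 / N) * Real.exp (-(1 / (N + 1) ^ 2)))) ^ k *
          Real.exp (-(2 * Real.pi * t))) := by
          gcongr
          refine hratio.trans ?_
          gcongr
      _ = 101 / 100 * (((1 + 1 / (N : ℝ)) ^ k * Real.exp (-(2 * Real.pi * t))) *
          Real.exp (k * -(1 / (N + 1) ^ 2))) * n ^ k := by
          rw [mul_pow, mul_pow, ← Real.exp_nat_mul]; ring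
      _ ≤ 101 / 100 * (Real.exp (-E) * Real.exp (k * -(1 / (N + 1) ^ 2))) * n ^ k := by gcongr
      _ = _ := by
          rw [← Real.exp_add]
          ring_nf

lemma Real.cot_le_inv {y : ℝ} (h0 : 0 < y) (h1 : y < Real.pi / 2) : Real.cot y ≤ 1 / y := by
  have h := Real.lt_tan h0 h1
  rw [← Real.tan_inv_eq_cot, ← one_div]
  exact one_div_le_one_div_of_le h0 h.le

lemma Real.inv_sub_le_cot {y : ℝ} (h0 : 0 < y) (h1 : y ≤ Real.pi / 6) :
    1 / y - 35 / 100 * y ≤ Real.cot y := by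
  have hpi := Real.pi_pos
  have hs : 0 < Real.sin y := Real.sin_pos_of_pos_of_lt_pi h0 (by linarith)
  have hd : ∀ x : ℝ, HasDerivAt
      (fun x : ℝ => x * Real.cos x - (1 - 35 / 100 * x ^ 2) * Real.sin x)
      (x * (35 / 100 * x * Real.cos x - 3 / 10 * Real.sin x)) x := by
    intro x
    have h := ((hasDerivAt_id' x).mul (Real.hasDerivAt_cos x)).sub
      ((((hasDerivAt_pow 2 x).const_mul (35 / 100)).const_sub 1).mul (Real.hasDerivAt_sin x))
    refine h.congr_deriv ?_
    norm_num
    ring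
  have hmono := monotoneOn_of_deriv_nonneg (convex_Icc 0 (Real.pi / 6))
    (fun x _ => (hd x).continuousAt.continuousWithinAt)
    (fun x _ => (hd x).differentiableAt.differentiableWithinAt)
    (fun x hx => by
      have hx' := interior_subset hx
      rw [(hd x).deriv]
      have hc : 6 / 7 ≤ Real.cos x := by
        refine le_trans ?_ (Real.cos_le_cos_of_nonneg_of_le_pi hx'.1 (by linarith) hx'.2)
        rw [Real.cos_pi_div_six]
        have : (12 / 7 : ℝ) ≤ √3 := Real.le_sqrt_of_sq_le (by norm_num)
        linarith
      have hsx := Real.sin_le hx'.1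
      have : x * (6 / 7) ≤ x * Real.cos x := mul_le_mul_of_nonneg_left hc hx'.1
      exact mul_nonneg hx'.1 (by nlinarith))
  have h := hmono (Set.left_mem_Icc.2 (by linarith)) ⟨h0.le, h1⟩ h0.le
  norm_num at h
  rw [Real.cot_eq_cos_div_sin, le_div_iff₀ hs]
  have e : (1 / y - 35 / 100 * y) * Real.sin y = (1 - 35 / 100 * y ^ 2) * Real.sin y / y := by
    field_simp
  rw [e, div_le_iff₀ h0]
  linarith

lemma two_pi_mul_cot_le {k n : ℕ} (hn : 1 ≤ n) (hnk : 6 * n ≤ k) :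
    2 * Real.pi * (Real.cot (n * Real.pi / (k + 1)) / 2) ≤ (k + 1) / n := by
  have hpi := Real.pi_pos
  have hn' : (1 : ℝ) ≤ n := by exact_mod_cast hn
  have hnk' : (6 : ℝ) * n ≤ k := by exact_mod_cast hnk
  have h := Real.cot_le_inv (y := n * Real.pi / (k + 1)) (by positivity) (by
    rw [div_lt_div_iff₀ (by positivity) (by positivity)]; nlinarith)
  calc 2 * Real.pi * (Real.cot (n * Real.pi / (k + 1)) / 2)
      = Real.pi * Real.cot (n * Real.pi / (k + 1)) := by ring
    _ ≤ Real.pi * (1 / (n * Real.pi / (k + 1))) := by gcongr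
    _ = _ := by field_simp

lemma le_two_pi_mul_cot {k n : ℕ} (hn : 1 ≤ n) (hnk : 6 * n ≤ k) :
    (k + 1) / n - 34545 / 10000 * n / (k + 1) ≤
      2 * Real.pi * (Real.cot (n * Real.pi / (k + 1)) / 2) := by
  have hpi := Real.pi_pos
  have hn' : (1 : ℝ) ≤ n := by exact_mod_cast hn
  have hnk' : (6 : ℝ) * n ≤ k := by exact_mod_cast hnk
  have h := Real.inv_sub_le_cot (y := n * Real.pi / (k + 1)) (by positivity) (by
    rw [div_le_div_iff₀ (by positivity) (by positivity)]; nlinarith)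
  have hpi2 : 35 / 100 * Real.pi ^ 2 ≤ 34545 / 10000 := by nlinarith [Real.pi_lt_d4]
  calc ((k : ℝ) + 1) / n - 34545 / 10000 * n / (k + 1)
      ≤ (k + 1) / n - 35 / 100 * Real.pi ^ 2 * n / (k + 1) := by gcongr
    _ = Real.pi * (1 / (n * Real.pi / (k + 1)) - 35 / 100 * (n * Real.pi / (k + 1))) := by
      field_simp
    _ ≤ Real.pi * Real.cot (n * Real.pi / (k + 1)) := by gcongr
    _ = _ := by ring

lemma exp_neg_le_of_mul_ge {x c : ℝ} (h : 1 ≤ c * Real.exp x) : Real.exp (-x) ≤ c := by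
  rw [Real.exp_neg, ← one_div, div_le_iff₀ (Real.exp_pos x)]
  exact h

lemma mul_exp_neg_one_le : 101 / 100 * Real.exp (-1) ≤ 372 / 1000 := by
  have := exp_neg_le_of_mul_ge (x := 1) (c := 3680 / 10000) (by nlinarith [Real.exp_one_gt_d9])
  linarith

lemma mul_exp_neg_dominant_le : 101 / 100 * Real.exp (-(968 / 1000)) ≤ 39 / 100 := by
  have h1 : Real.exp (968 / 1000) = Real.exp 1 * Real.exp (-(32 / 1000)) := by
    rw [← Real.exp_add]; norm_num
  have h2 := Real.one_sub_le_exp_neg (32 / 1000)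
  have h3 : (968 / 1000 : ℝ) * 2.718 ≤ Real.exp (968 / 1000) := by
    rw [h1, mul_comm]
    gcongr
    · exact (by norm_num : (2.718 : ℝ) ≤ 2.7182818283).trans Real.exp_one_gt_d9.le
    · linarith
  have := exp_neg_le_of_mul_ge (x := 968 / 1000) (c := 386 / 1000) (by nlinarith)
  linarith

lemma mul_exp_neg_tail_le :
    101 / 100 * Real.exp (-(968 / 1000) - 4 / 3) ≤ 105 / 1000 := by
  have h0 := mul_exp_neg_dominant_le
  have h1 : Real.exp (4 / 3) = Real.exp 1 * Real.exp (1 / 3) := by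
    rw [← Real.exp_add]; norm_num
  have h2 := Real.quadratic_le_exp_of_nonneg (x := 1 / 3) (by norm_num)
  have h3 : (2.718 : ℝ) * (25 / 18) ≤ Real.exp (4 / 3) := by
    rw [h1]
    gcongr
    · exact (by norm_num : (2.718 : ℝ) ≤ 2.7182818283).trans Real.exp_one_gt_d9.le
    · linarith
  have h4 := exp_neg_le_of_mul_ge (x := 4 / 3) (c := 265 / 1000) (by nlinarith)
  rw [sub_eq_add_neg, Real.exp_add, ← mul_assoc]
  calc _ ≤ 39 / 100 * (265 / 1000 : ℝ) := by gcongr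
    _ ≤ _ := by norm_num

lemma mul_exp_neg_low_le : 101 / 100 * Real.exp (-(11 / 2)) ≤ 1 / 100 := by
  have h1 : Real.exp (11 / 2) = Real.exp 1 ^ 5 * Real.exp (1 / 2) := by
    rw [← Real.exp_nat_mul, ← Real.exp_add]; norm_num
  have h2 := Real.quadratic_le_exp_of_nonneg (x := 1 / 2) (by norm_num)
  have h3 : (2.718 : ℝ) ^ 5 * (13 / 8) ≤ Real.exp (11 / 2) := by
    rw [h1]
    gcongr
    · exact (by norm_num : (2.718 : ℝ) ≤ 2.7182818283).trans Real.exp_one_gt_d9.le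
    · linarith
  have := exp_neg_le_of_mul_ge (x := 11 / 2) (c := 9 / 1000) (by norm_num at h3; nlinarith)
  linarith

section Ratios

variable {k m : ℕ} {t : ℝ}

lemma fourierTerm_low_ratio (hm : 1 ≤ m) (hk : 12 * m ^ 2 ≤ k) (ht : 2 * Real.pi * t ≤ (k + 1) / m)
    {n : ℕ} (hn : n < m) : fourierTerm k t n ≤ 1 / 100 * fourierTerm k t (n + 1) := by
  have hk12 : 12 ≤ k := by nlinarith
  rcases Nat.eq_zero_or_pos n with rfl | hn0
  · have := fourierTerm_nonneg k t (0 + 1)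
    have h0 : fourierTerm k t 0 = 0 := by simp [fourierTerm]
    rw [h0]; positivity
  have hm2 : (2 : ℝ) ≤ m := by exact_mod_cast (by omega : 2 ≤ m)
  have hk' : (12 : ℝ) * m ^ 2 ≤ k := by exact_mod_cast hk
  refine (fourierTerm_le_exp_mul_succ hk12 hn ht).trans ?_
  have hnn := fourierTerm_nonneg k t (n + 1)
  gcongr
  refine le_trans ?_ mul_exp_neg_low_le
  gcongr
  have h1 : 1 / (m : ℝ) ≤ 1 / 2 := by gcongr
  have h2 : (6 : ℝ) ≤ k / (2 * m ^ 2) := by rw [le_div_iff₀ (by positivity)]; linarith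
  linarith

lemma fourierTerm_le_succ_at_left (hm : 1 ≤ m) (hk : 12 * m ^ 2 ≤ k)
    (ht : 2 * Real.pi * t ≤ (k + 1) / (m + 1 : ℕ)) :
    fourierTerm k t m ≤ 372 / 1000 * fourierTerm k t (m + 1) := by
  have hk12 : 12 ≤ k := by nlinarith
  have hm1 : (1 : ℝ) ≤ m := by exact_mod_cast hm
  have hk' : (12 : ℝ) * m ^ 2 ≤ k := by exact_mod_cast hk
  refine (fourierTerm_le_exp_mul_succ hk12 le_rfl ht).trans ?_
  have hnn := fourierTerm_nonneg k t (m + 1)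
  gcongr
  refine le_trans ?_ mul_exp_neg_one_le
  gcongr
  push_cast
  have e : 1 / ((m : ℝ) + 1) - k / (2 * (m + 1) ^ 2) = (2 * (m + 1) - k) / (2 * (m + 1) ^ 2) := by
    field_simp
  rw [e, div_le_iff₀ (by positivity)]
  nlinarith

lemma exponent_identity (k : ℝ) {N : ℝ} (hN : 0 < N) (c : ℝ) :
    k / N - k / (2 * N ^ 2) + k / (3 * N ^ 3) +
      (k * (3 * N - 2) / (6 * N ^ 3) + 1 / N - c) = (k + 1) / N - c := by
  field_simp
  ring

lemma correction_le {k N : ℝ} (hN : 0 ≤ N) (hk : 6 * N ≤ k) :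
    34545 / 10000 * N / (k + 1) ≤ 576 / 1000 := by
  rw [div_le_iff₀ (by linarith)]
  linarith

lemma dominant_exponent_ge (hm : 1 ≤ m) (hk : 12 * m ^ 2 ≤ k) (hmk : 6 * (m + 1) ≤ k) :
    (968 / 1000 : ℝ) ≤ k * (3 * (m + 1) - 2) / (6 * (m + 1 : ℝ) ^ 3) + 1 / (m + 1) -
      34545 / 10000 * (m + 1) / (k + 1) := by
  have hk' : (12 : ℝ) * m ^ 2 ≤ k := by exact_mod_cast hk
  have hmk' : (6 : ℝ) * (m + 1) ≤ k := by exact_mod_cast hmk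
  rcases Nat.lt_or_ge m 2 with h | h
  · obtain rfl : m = 1 := by omega
    have hk12 : (12 : ℝ) ≤ k := by exact_mod_cast hk
    have h1 : 34545 / 10000 * (((1 : ℕ) : ℝ) + 1) / (k + 1) ≤ 5315 / 10000 := by
      norm_num
      rw [div_le_iff₀ (by positivity)]; linarith
    norm_num at h1 ⊢
    linarith
  · have h2 : (2 : ℝ) ≤ m := by exact_mod_cast h
    have h1 := correction_le (by positivity) hmk'
    have h3 : (2 : ℝ) ≤ k * (3 * (m + 1) - 2) / (6 * (m + 1 : ℝ) ^ 3) := by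
      rw [le_div_iff₀ (by positivity)]
      have : (12 * m ^ 2) * (3 * (m + 1) - 2) ≤ k * (3 * (m + 1) - 2 : ℝ) :=
        mul_le_mul_of_nonneg_right hk' (by linarith)
      have h4 : 0 ≤ (m - 2 : ℝ) * m ^ 2 := by
        have : (0 : ℝ) ≤ m - 2 := by linarith
        positivity
      nlinarith
    have h4 : (0 : ℝ) ≤ 1 / (m + 1) := by positivity
    linarith

lemma fourierTerm_upper_ratio (hm : 1 ≤ m) (hk : 12 * m ^ 2 ≤ k) (hmk : 6 * (m + 1) ≤ k)
    (ht : (k + 1) / (m + 1 : ℕ) - 34545 / 10000 * (m + 1 : ℕ) / (k + 1) ≤ 2 * Real.pi * t) :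
    fourierTerm k t (m + 2) ≤ 39 / 100 * fourierTerm k t (m + 1) ∧
    ∀ n, m + 2 ≤ n → fourierTerm k t (n + 1) ≤ 105 / 1000 * fourierTerm k t n := by
  have hk12 : 12 ≤ k := by nlinarith
  have hm1 : (1 : ℝ) ≤ m := by exact_mod_cast hm
  have hk' : (12 : ℝ) * m ^ 2 ≤ k := by exact_mod_cast hk
  have hE := dominant_exponent_ge hm hk hmk
  have hid := exponent_identity k (by positivity : (0 : ℝ) < m + 1)
    (34545 / 10000 * (m + 1) / (k + 1))
  push_cast at ht
  have h := fourierTerm_succ_le_exp_mul hk12 (t := t) (N := m + 1) (E := 968 / 1000) (by omega)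
    (by push_cast; linarith)
  refine ⟨h.1.trans (mul_le_mul_of_nonneg_right mul_exp_neg_dominant_le
    (fourierTerm_nonneg _ _ _)), fun n hn => (h.2 n hn).trans
    (mul_le_mul_of_nonneg_right (le_trans ?_ mul_exp_neg_tail_le) (fourierTerm_nonneg _ _ _))⟩
  have : (4 / 3 : ℝ) ≤ k / (((m + 1 : ℕ) : ℝ) + 1) ^ 2 := by
    push_cast
    rw [le_div_iff₀ (by positivity)]
    nlinarith
  gcongr

lemma fourierTerm_succ_le_at_right (hm : 1 ≤ m) (hk : 12 * m ^ 2 ≤ k) (hmk : 6 * (m + 1) ≤ k)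
    (ht : (k + 1) / m - 34545 / 10000 * m / (k + 1) ≤ 2 * Real.pi * t) :
    fourierTerm k t (m + 1) ≤ 39 / 100 * fourierTerm k t m := by
  have hk12 : 12 ≤ k := by nlinarith
  have hm1 : (1 : ℝ) ≤ m := by exact_mod_cast hm
  have hk' : (12 : ℝ) * m ^ 2 ≤ k := by exact_mod_cast hk
  have hmk' : (6 : ℝ) * m ≤ k := by exact_mod_cast (by omega : 6 * m ≤ k)
  have hid := exponent_identity k (by positivity : (0 : ℝ) < m) (34545 / 10000 * m / (k + 1))
  have h1 := correction_le (by positivity) hmk'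
  have h3 : (2 : ℝ) ≤ k * (3 * m - 2) / (6 * (m : ℝ) ^ 3) := by
    rw [le_div_iff₀ (by positivity)]
    have : (12 * m ^ 2) * (3 * m - 2) ≤ k * (3 * m - 2 : ℝ) :=
      mul_le_mul_of_nonneg_right hk' (by linarith)
    have h4 : 0 ≤ (m - 1 : ℝ) * m ^ 2 := by
      have : (0 : ℝ) ≤ m - 1 := by linarith
      positivity
    nlinarith
  have h4 : (0 : ℝ) ≤ 1 / m := by positivity
  have h := fourierTerm_succ_le_exp_mul hk12 (t := t) hm (E := 968 / 1000) (by linarith)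
  exact h.1.trans (mul_le_mul_of_nonneg_right mul_exp_neg_dominant_le (fourierTerm_nonneg _ _ _))

end Ratios

section Fourier

variable {k m : ℕ} {t : ℝ}

lemma summable_fourierTerm (k : ℕ) (ht : 0 < t) : Summable (fourierTerm k t) :=
  (summable_pow_mul_fourierTerm k 0 ht).congr fun n => by rw [pow_zero, one_mul]

lemma realSeries_one_eq_tsum (k : ℕ) (t : ℝ) :
    realSeries k 1 t = ∑' n : ℕ, (-1) ^ n * fourierTerm k t n := by
  simpa using realSeries_eq_tsum_fourierTerm k 0 t

lemma realSeries_sign_at_right (hm : 1 ≤ m) (hk : 12 * m ^ 2 ≤ k) (hmk : 6 * (m + 1) ≤ k)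
    (ht : 0 < t) (hle : 2 * Real.pi * t ≤ (k + 1) / m)
    (hge : (k + 1) / m - 34545 / 10000 * m / (k + 1) ≤ 2 * Real.pi * t)
    (hge' : (k + 1) / (m + 1 : ℕ) - 34545 / 10000 * (m + 1 : ℕ) / (k + 1) ≤ 2 * Real.pi * t) :
    0 < (-1) ^ m * realSeries k 1 t := by
  have hup := fourierTerm_upper_ratio hm hk hmk hge'
  have hdom := fourierTerm_succ_le_at_right hm hk hmk hge
  have hnn := fourierTerm_nonneg k t
  have hpos := fourierTerm_pos (by omega : 12 ≤ k) t hm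
  have hlow := one_sub_mul_sum_range_succ_le (c := fourierTerm k t) (ρ := 1 / 100) (M := m) (hnn 0)
    (by norm_num) fun n hn => fourierTerm_low_ratio hm hk hle hn
  have htail := tsum_nat_add_le_of_ratio (c := fourierTerm k t) (ρ := 39 / 100) (M := m + 1) hnn
    (by norm_num) (by norm_num) fun n hn => by
      rcases eq_or_lt_of_le hn with rfl | hn'
      · exact hup.1
      · have := hup.2 n hn'
        have := hnn n
        linarith
  rw [le_div_iff₀ (by norm_num)] at htail
  rw [realSeries_one_eq_tsum]
  refine neg_one_pow_mul_tsum_pos (summable_fourierTerm k ht) hnn ?_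
  rw [Finset.sum_range_succ] at hlow
  linarith

lemma realSeries_sign_at_left (hm : 1 ≤ m) (hk : 12 * m ^ 2 ≤ k) (hmk : 6 * (m + 1) ≤ k)
    (ht : 0 < t) (hle : 2 * Real.pi * t ≤ (k + 1) / m)
    (hle' : 2 * Real.pi * t ≤ (k + 1) / (m + 1 : ℕ))
    (hge : (k + 1) / (m + 1 : ℕ) - 34545 / 10000 * (m + 1 : ℕ) / (k + 1) ≤ 2 * Real.pi * t) :
    0 < (-1) ^ (m + 1) * realSeries k 1 t := by
  have hup := fourierTerm_upper_ratio hm hk hmk hge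
  have hdom := fourierTerm_le_succ_at_left hm hk hle'
  have hnn := fourierTerm_nonneg k t
  have hpos := fourierTerm_pos (by omega : 12 ≤ k) t (by omega : 1 ≤ m + 1)
  have hlow := one_sub_mul_sum_range_succ_le (c := fourierTerm k t) (ρ := 1 / 100) (M := m) (hnn 0)
    (by norm_num) fun n hn => fourierTerm_low_ratio hm hk hle hn
  have htail := tsum_nat_add_le_of_ratio (c := fourierTerm k t) (ρ := 105 / 1000) (M := m + 1 + 1)
    hnn (by norm_num) (by norm_num) hup.2
  have hup1 := hup.1
  rw [le_div_iff₀ (by norm_num)] at htail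
  rw [realSeries_one_eq_tsum]
  refine neg_one_pow_mul_tsum_pos (summable_fourierTerm k ht) hnn ?_
  linarith

lemma mul_realSeries_sub_ne_zero (hm : 1 ≤ m) (hk : 12 * m ^ 2 ≤ k) (hmk : 6 * (m + 1) ≤ k)
    (ht : 0 < t) (hle : 2 * Real.pi * t ≤ (k + 1) / m)
    (hge : (k + 1) / (m + 1 : ℕ) - 34545 / 10000 * (m + 1 : ℕ) / (k + 1) ≤ 2 * Real.pi * t) :
    (m + 1 / 10 : ℝ) * realSeries k 1 t - realSeries k 2 t ≠ 0 := by
  have hup := fourierTerm_upper_ratio hm hk hmk hge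
  have hs := summable_fourierTerm k ht
  have hs' : Summable fun n : ℕ => (n : ℝ) * fourierTerm k t n := by
    simpa using summable_pow_mul_fourierTerm k 1 ht
  have h := tsum_sub_mul_neg_one_pow_ne_zero hs' hs (fourierTerm_nonneg k t)
    (fourierTerm_pos (by omega : 12 ≤ k) t (by omega : 1 ≤ m + 1))
    (fun n hn => fourierTerm_low_ratio hm hk hle hn) hup.1 hup.2
  convert h using 1
  have ha : Summable fun n : ℕ => (-1) ^ n * fourierTerm k t n :=
    Summable.of_abs (hs.congr fun n => by
      rw [abs_mul, abs_neg_one_pow, one_mul, abs_of_nonneg (fourierTerm_nonneg k t n)])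
  have hb : Summable fun n : ℕ => (n : ℝ) * ((-1) ^ n * fourierTerm k t n) :=
    Summable.of_abs (hs'.congr fun n => by
      rw [abs_mul, abs_mul, abs_neg_one_pow, one_mul, abs_of_nonneg (fourierTerm_nonneg k t n),
        Nat.abs_cast])
  have h2 : realSeries k 2 t = ∑' n : ℕ, (n : ℝ) * ((-1) ^ n * fourierTerm k t n) := by
    simpa using realSeries_eq_tsum_fourierTerm k 1 t
  rw [realSeries_one_eq_tsum, h2, ← tsum_mul_left, ← (ha.mul_left _).tsum_sub hb]
  exact tsum_congr fun n => by ring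

lemma exists_mul_realSeries_sub_eq_zero (k : ℕ) (c : ℝ) {x y : ℝ} (hx0 : 0 < x) (hxy : x < y)
    (hx : realSeries k 1 x = 0) (hy : realSeries k 1 y = 0) :
    ∃ s ∈ Set.Ioo x y, c * realSeries k 1 s - realSeries k 2 s = 0 := by
  have hd : ∀ s, 0 < s → HasDerivAt (fun s => Real.exp (2 * Real.pi * c * s) * realSeries k 1 s)
      (2 * Real.pi * Real.exp (2 * Real.pi * c * s) *
        (c * realSeries k 1 s - realSeries k 2 s)) s := fun s hs => by
    have h := (((hasDerivAt_id' s).const_mul (2 * Real.pi * c)).exp).mul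
      (hasDerivAt_realSeries k 1 hs)
    refine h.congr_deriv ?_
    ring
  obtain ⟨s, hs, h⟩ := exists_hasDerivAt_eq_zero hxy
    (fun s hs => (hd s (hx0.trans_le hs.1)).continuousAt.continuousWithinAt)
    (by rw [hx, hy, mul_zero, mul_zero]) (fun s hs => hd s (hx0.trans hs.1))
  exact ⟨s, hs, (mul_eq_zero.1 h).resolve_left (by positivity)⟩

lemma mul_pi_div_lt_pi_div_six (h : 6 * m ≤ k) :
    (m : ℝ) * Real.pi / (k + 1) < Real.pi / 6 := by
  have h' : (6 : ℝ) * m ≤ k := by exact_mod_cast h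
  rw [div_lt_div_iff₀ (by positivity) (by positivity)]
  nlinarith [Real.pi_pos]

lemma cot_succ_lt_cot (hm : 1 ≤ m) (hmk : 6 * (m + 1) ≤ k) :
    Real.cot ((m + 1 : ℕ) * Real.pi / (k + 1)) < Real.cot (m * Real.pi / (k + 1)) := by
  have hm1 : (1 : ℝ) ≤ m := by exact_mod_cast hm
  have h := mul_pi_div_lt_pi_div_six hmk
  refine Real.cot_lt_cot (by positivity) ?_ (by linarith [Real.pi_pos])
  gcongr
  omega

lemma cot_pos (hm : 1 ≤ m) (hmk : 6 * m ≤ k) : 0 < Real.cot (m * Real.pi / (k + 1)) := by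
  have hm1 : (1 : ℝ) ≤ m := by exact_mod_cast hm
  have h := mul_pi_div_lt_pi_div_six hmk
  have hpi := Real.pi_pos
  rw [Real.cot_eq_cos_div_sin]
  have h0 : 0 < (m : ℝ) * Real.pi / (k + 1) := by positivity
  exact div_pos (Real.cos_pos_of_mem_Ioo ⟨by linarith, by linarith⟩)
    (Real.sin_pos_of_pos_of_lt_pi h0 (by linarith))

theorem existsUnique_zero_of_fourier (hm : 1 ≤ m) (hk : 12 * m ^ 2 ≤ k) (hmk : 6 * (m + 1) ≤ k) :
    ∃! s, s ∈ Set.Ioo (Real.cot ((m + 1 : ℕ) * Real.pi / (k + 1)) / 2)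
      (Real.cot (m * Real.pi / (k + 1)) / 2) ∧ realSeries k 1 s = 0 := by
  have hpi := Real.pi_pos
  have hmk' : 6 * m ≤ k := by omega
  have hle := two_pi_mul_cot_le hm hmk'
  have hge := le_two_pi_mul_cot hm hmk'
  have hle' := two_pi_mul_cot_le (by omega : 1 ≤ m + 1) hmk
  have hge' := le_two_pi_mul_cot (by omega : 1 ≤ m + 1) hmk
  have hlt := cot_succ_lt_cot hm hmk
  have hpos := cot_pos (by omega : 1 ≤ m + 1) hmk
  set a := Real.cot ((m + 1 : ℕ) * Real.pi / (k + 1)) / 2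
  set b := Real.cot (m * Real.pi / (k + 1)) / 2
  have ha : 0 < a := half_pos hpos
  have hab : a < b := div_lt_div_of_pos_right hlt two_pos
  have hpab : 2 * Real.pi * a ≤ 2 * Real.pi * b := by gcongr
  have hl := realSeries_sign_at_left hm hk hmk ha (hpab.trans hle) hle' hge'
  refine existsUnique_zero_Ioo (ε := (-1) ^ m) hab
    ((continuousOn_realSeries k 1).mono fun x hx => ha.trans_le hx.1)
    (by rw [pow_succ] at hl; linarith)
    (realSeries_sign_at_right hm hk hmk (ha.trans hab) hle hge (hge'.trans hpab)) ?_
  intro x y hax hxy hyb hx hy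
  obtain ⟨s, hs, h⟩ := exists_mul_realSeries_sub_eq_zero k (m + 1 / 10) (ha.trans hax) hxy hx hy
  have h1 : 2 * Real.pi * a ≤ 2 * Real.pi * s := by gcongr; linarith [hs.1]
  have h2 : 2 * Real.pi * s ≤ 2 * Real.pi * b := by gcongr; linarith [hs.2]
  exact mul_realSeries_sub_ne_zero hm hk hmk (by linarith [hs.1]) (h2.trans hle) (hge'.trans h1) h

end Fourier

/-- A unique zero of the real series in an interval of positive reals is a unique zero of `E_k'` on
the corresponding vertical segment. -/
lemma existsUnique_deriv_Ek {k : ℕ} (hke : Even k) (h0 : k ≠ 0) {a b : ℝ} (ha : 0 ≤ a)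
    (h : ∃! s, s ∈ Set.Ioo a b ∧ realSeries k 1 s = 0) :
    ∃! s : ℝ, s ∈ Set.Ioo a b ∧ deriv (Ek k) (1 / 2 + s * Complex.I) = 0 := by
  refine (existsUnique_congr fun s => and_congr_right fun hs => ?_).2 h
  exact deriv_Ek_eq_zero_iff hke h0 (ha.trans_lt hs.1)

lemma cot_pi_div_six : Real.cot (Real.pi / 6) = √3 := by
  rw [Real.cot_eq_cos_div_sin, Real.cos_pi_div_six, Real.sin_pi_div_six]
  ring

theorem stmt2 (k : ℕ) (hke : Even k) (hk4 : 4 ≤ k) :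
    let M := k / 6
    let t : ℕ → ℝ := fun m => Real.cot (m * Real.pi / (k + 1)) / 2
    (∀ m : ℕ, 1 ≤ m → m + 1 ≤ M → t (m + 1) < t m) ∧
    (1 ≤ M → Real.sqrt 3 / 2 < t M) ∧
    (∀ m : ℕ, 1 ≤ m → m ≤ M - 1 →
      ∃! s : ℝ, s ∈ Set.Ioo (t (m + 1)) (t m) ∧
        deriv (Ek k) (1 / 2 + s * Complex.I) = 0) ∧
    (k % 6 = 4 → k ≠ 4 →
      ∃! s : ℝ, s ∈ Set.Ioo (Real.sqrt 3 / 2) (t M) ∧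
        deriv (Ek k) (1 / 2 + s * Complex.I) = 0) := by
  intro M t
  have hpi := Real.pi_pos
  refine ⟨fun m hm hmM => ?_, fun hM => ?_, fun m hm hmM => ?_, fun hmod hne => ?_⟩
  · exact div_lt_div_of_pos_right (cot_succ_lt_cot hm (by omega)) two_pos
  · have hM' : (1 : ℝ) ≤ M := by exact_mod_cast hM
    have h := Real.cot_lt_cot (by positivity)
      (mul_pi_div_lt_pi_div_six (m := M) (k := k) (by omega)) (by linarith)
    rw [cot_pi_div_six] at h
    exact div_lt_div_of_pos_right h two_pos
  · have hmk : 6 * (m + 1) ≤ k := by omega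
    refine existsUnique_deriv_Ek hke (by omega) (half_pos (cot_pos (by omega) hmk)).le ?_
    rcases Nat.lt_or_ge (12 * m ^ 2) (k + 1) with hlt | hge
    · exact existsUnique_zero_of_fourier hm (by omega) hmk
    · have h := existsUnique_zero_of_lattice (by omega : 10 ≤ k) hm hge
        (β := (m + 1 : ℕ) * Real.pi / (k + 1 : ℕ)) (by gcongr; omega)
        (by push_cast; exact_mod_cast (mul_pi_div_lt_pi_div_six hmk).le) (by push_cast; rfl)
        (by
          rw [mul_div_cancel₀ _ (by positivity), Real.cos_nat_mul_pi, ← pow_add,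
            Odd.neg_one_pow ⟨m, by ring⟩]
          norm_num)
      push_cast at h ⊢
      simpa [t] using h
  · have hM : k = 6 * M + 4 := by omega
    have hM1 : 1 ≤ M := by omega
    have hkM : (k : ℝ) = 6 * M + 4 := by exact_mod_cast hM
    refine existsUnique_deriv_Ek hke (by omega) (by positivity) ?_
    have h := existsUnique_zero_of_lattice (by omega : 10 ≤ k) hM1 (by nlinarith)
      (β := Real.pi / 6)
      (by push_cast; exact mul_pi_div_lt_pi_div_six (by omega)) le_rfl
      (by
        push_cast
        rw [div_le_div_iff₀ (by positivity) (by positivity), hkM]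
        nlinarith)
      (by
        have e : ((k + 1 : ℕ) : ℝ) * (Real.pi / 6) = (Real.pi - Real.pi / 6) + M * Real.pi := by
          push_cast; rw [hkM]; ring
        rw [e, Real.cos_add_nat_mul_pi, ← mul_assoc, ← mul_pow, neg_one_mul, neg_neg, one_pow,
          one_mul, Real.cos_pi_sub, Real.cos_pi_div_six]
        have : (12 / 7 : ℝ) ≤ √3 := Real.le_sqrt_of_sq_le (by norm_num)
        linarith)
    rw [cot_pi_div_six] at h
    push_cast at h
    exact h
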